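/- For any finite n and p, any constant t > 0, and any real γ₁ with cos(0.3π) < γ₁ < 1, if the tuning parameter satisfies λ/n ∈ [3σ₀²(|τ₀|+1)(log(p−|τ₀|) + log(|τ₀|) + 2/3)/n + t, (1−γ₁²)·C_min/6], then the probability that the true model is not in the penalized candidate set satisfies ℙ_{(𝒰^d,Y)}(τ₀ ∉ S^(d)) ≤ L(γ₁) + 3·exp(−n·t/(3σ₀²)) + [2·(arccos γ₁)^{n−|τ₀|−1}·p^{|τ₀|}]^d, where L(γ₁) = 6·exp[−(n/(18σ₀²))·{(1−γ₁²)·C_min − 36·(log p / n)·σ₀²}]. -/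

import Mathlib

open MeasureTheory ProbabilityTheory Matrix Filter
open scoped ENNReal Classical

noncomputable section

namespace ReproSamples

/-- Squared Euclidean norm of a vector in `ℝⁿ`. -/
def sqnorm {n : ℕ} (v : Fin n → ℝ) : ℝ := ∑ i, (v i) ^ 2

/-- The vector `β` with all coordinates outside `τ` set to `0`; this encodes the
vector `β_τ ∈ ℝ^{|τ|}`, so that `X_τ β_τ = X.mulVec (maskOn τ β)`. -/
def maskOn {p : ℕ} (τ : Finset (Fin p)) (β : Fin p → ℝ) : Fin p → ℝ :=
  fun j => if j ∈ τ then β j else 0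

/-- The submatrix `X_τ` of the columns of `X` indexed by `τ`. -/
def subcols {n p : ℕ} (X : Matrix (Fin n) (Fin p) ℝ) (τ : Finset (Fin p)) :
    Matrix (Fin n) {j // j ∈ τ} ℝ :=
  Matrix.of fun i j => X i j.1

/-- The matrix `M (MᵀM)⁻¹ Mᵀ` (orthogonal projection onto the column span of `M`
when `MᵀM` is invertible). -/
def projMat {n : ℕ} {m : Type} [Fintype m] [DecidableEq m]
    (M : Matrix (Fin n) m ℝ) : Matrix (Fin n) (Fin n) ℝ :=
  M * (Mᵀ * M)⁻¹ * Mᵀ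

/-- The projection matrix `H_τ = X_τ (X_τᵀ X_τ)⁻¹ X_τᵀ`. -/
def proj {n p : ℕ} (X : Matrix (Fin n) (Fin p) ℝ) (τ : Finset (Fin p)) :
    Matrix (Fin n) (Fin n) ℝ :=
  projMat (subcols X τ)

/-- Identifiability: `τ₀` is the unique minimizer of `|τ|` over
`{τ : X_τ β_τ = X_{τ₀} β₀ for some β_τ}` (here `β₀` is supported on `τ₀`). -/
def Identifiable {n p : ℕ} (X : Matrix (Fin n) (Fin p) ℝ) (τ₀ : Finset (Fin p))
    (β₀ : Fin p → ℝ) : Prop :=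
  ∀ τ : Finset (Fin p), (∃ β : Fin p → ℝ, X.mulVec (maskOn τ β) = X.mulVec β₀) →
    τ ≠ τ₀ → τ₀.card < τ.card

/-- The separation constant `C_min`. -/
def Cmin {n p : ℕ} (X : Matrix (Fin n) (Fin p) ℝ) (τ₀ : Finset (Fin p))
    (β₀ : Fin p → ℝ) : ℝ :=
  sInf ((fun τ : Finset (Fin p) =>
      sqnorm ((1 - proj X τ).mulVec (X.mulVec β₀)) /
        ((n * max (τ₀ \ τ).card 1 : ℕ) : ℝ)) ''
    {τ : Finset (Fin p) | τ ≠ τ₀ ∧ τ.card ≤ τ₀.card})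

/-- Penalized objective `min_{β_τ, σ} ‖y − X_τ β_τ − σ u*‖² + λ|τ|`. -/
def objPen {n p : ℕ} (X : Matrix (Fin n) (Fin p) ℝ) (lam : ℝ) (y ustar : Fin n → ℝ)
    (τ : Finset (Fin p)) : ℝ :=
  (⨅ bs : (Fin p → ℝ) × ℝ, sqnorm (y - X.mulVec (maskOn τ bs.1) - bs.2 • ustar)) +
    lam * τ.card

/-- Un-penalized objective `min_{β_τ, σ} ‖y − X_τ β_τ − σ u*‖²`. -/
def objFit {n p : ℕ} (X : Matrix (Fin n) (Fin p) ℝ) (y ustar : Fin n → ℝ)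
    (τ : Finset (Fin p)) : ℝ :=
  ⨅ bs : (Fin p → ℝ) × ℝ, sqnorm (y - X.mulVec (maskOn τ bs.1) - bs.2 • ustar)

/-- Standard Gaussian measure `N(0, I_n)` on `ℝⁿ`. -/
def stdGaussian (n : ℕ) : Measure (Fin n → ℝ) :=
  Measure.pi fun _ => gaussianReal 0 1

/-- Joint law of `(U, (U*_1, …, U*_d))`, all i.i.d. `N(0, I_n)`. -/
def jointMeasure (n d : ℕ) : Measure ((Fin n → ℝ) × (Fin d → Fin n → ℝ)) :=
  (stdGaussian n).prod (Measure.pi fun _ : Fin d => stdGaussian n)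

/-- Squared cosine of the angle between two vectors. -/
def rho {n : ℕ} (v w : Fin n → ℝ) : ℝ := (v ⬝ᵥ w) ^ 2 / (sqnorm v * sqnorm w)

/-- `ρ_{τ⊥}(v, w) = ρ((I−H_τ)v, (I−H_τ)w)`. -/
def rhoPerp {n p : ℕ} (X : Matrix (Fin n) (Fin p) ℝ) (τ : Finset (Fin p))
    (v w : Fin n → ℝ) : ℝ :=
  rho ((1 - proj X τ).mulVec v) ((1 - proj X τ).mulVec w)

/-- `ρ(v, τ) = ‖H_τ v‖²/‖v‖²`. -/
def rhoTau {n p : ℕ} (X : Matrix (Fin n) (Fin p) ℝ) (v : Fin n → ℝ)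
    (τ : Finset (Fin p)) : ℝ :=
  sqnorm ((proj X τ).mulVec v) / sqnorm v

/-- The augmented matrix `(X_τ, u)`. -/
def augcols {n p : ℕ} (X : Matrix (Fin n) (Fin p) ℝ) (τ : Finset (Fin p))
    (u : Fin n → ℝ) : Matrix (Fin n) ({j // j ∈ τ} ⊕ Unit) ℝ :=
  Matrix.of fun i j => Sum.elim (fun k : {j // j ∈ τ} => X i k.1) (fun _ => u i) j

/-- The projection matrix `H_{τ,u}` onto the column span of `(X_τ, u)`. -/
def projAug {n p : ℕ} (X : Matrix (Fin n) (Fin p) ℝ) (τ : Finset (Fin p))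
    (u : Fin n → ℝ) : Matrix (Fin n) (Fin n) ℝ :=
  projMat (augcols X τ u)

/-- `γ²_{(u, τ₀)} = 1 − min_{|τ| < |τ₀|} ‖(I−H_{τ,u})X_{τ₀}β₀‖²/‖(I−H_τ)X_{τ₀}β₀‖²`. -/
def gammaSq {n p : ℕ} (X : Matrix (Fin n) (Fin p) ℝ) (τ₀ : Finset (Fin p))
    (β₀ : Fin p → ℝ) (u : Fin n → ℝ) : ℝ :=
  1 - sInf ((fun τ : Finset (Fin p) =>
      sqnorm ((1 - projAug X τ u).mulVec (X.mulVec β₀)) /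
        sqnorm ((1 - proj X τ).mulVec (X.mulVec β₀))) ''
    {τ : Finset (Fin p) | τ.card < τ₀.card})

/-- Residual sum of squares `min_β ‖y − X_τ β‖²`. -/
def rss {n p : ℕ} (X : Matrix (Fin n) (Fin p) ℝ) (y : Fin n → ℝ)
    (τ : Finset (Fin p)) : ℝ :=
  ⨅ β : Fin p → ℝ, sqnorm (y - X.mulVec (maskOn τ β))

/-- `Y*_w = a + b (I−H_τ)u / ‖(I−H_τ)u‖`. -/
def ystar {n p : ℕ} (X : Matrix (Fin n) (Fin p) ℝ) (τ : Finset (Fin p))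
    (a : Fin n → ℝ) (b : ℝ) (u : Fin n → ℝ) : Fin n → ℝ :=
  a + (b / Real.sqrt (sqnorm ((1 - proj X τ).mulVec u))) • ((1 - proj X τ).mulVec u)

/-- `p_{(w,τ)}(τ') = ℙ(T̃(Y*_w, τ) = τ')`. -/
def pfun {n p : ℕ} (X : Matrix (Fin n) (Fin p) ℝ)
    (Tt : (Fin n → ℝ) → Finset (Fin p) → Finset (Fin p))
    (τ : Finset (Fin p)) (a : Fin n → ℝ) (b : ℝ) (τ' : Finset (Fin p)) : ℝ :=
  ((stdGaussian n) {u | Tt (ystar X τ a b u) τ = τ'}).toReal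

/-- `B_α(τ, w) = {τ* : ∑_{τ' : p(τ') ≤ p(τ*)} p(τ') ≥ 1 − α}`. -/
def Bset {n p : ℕ} (X : Matrix (Fin n) (Fin p) ℝ)
    (Tt : (Fin n → ℝ) → Finset (Fin p) → Finset (Fin p)) (α : ℝ)
    (τ : Finset (Fin p)) (a : Fin n → ℝ) (b : ℝ) : Set (Finset (Fin p)) :=
  {τstar | 1 - α ≤
    ∑ τ' ∈ Finset.univ.filter (fun τ' => pfun X Tt τ a b τ' ≤ pfun X Tt τ a b τstar),
      pfun X Tt τ a b τ'}

/-- `τ ∈ Γ̄^τ_α(y)`-membership test: `T̃(y,τ) ∈ B_α(τ, W̃(y,τ))` with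
`W̃(y,τ) = (H_τ y, ‖(I−H_τ)y‖)`. -/
def inCS {n p : ℕ} (X : Matrix (Fin n) (Fin p) ℝ)
    (Tt : (Fin n → ℝ) → Finset (Fin p) → Finset (Fin p)) (α : ℝ)
    (y : Fin n → ℝ) (τ : Finset (Fin p)) : Prop :=
  Tt y τ ∈ Bset X Tt α τ ((proj X τ).mulVec y)
    (Real.sqrt (sqnorm ((1 - proj X τ).mulVec y)))

/-- `O_{τ,Λ}`: orthogonal projection onto the column span of `(I−H_{τ∖Λ}) X_{Λ∩τ}`. -/
def projO {n p : ℕ} (X : Matrix (Fin n) (Fin p) ℝ) (τ Λ : Finset (Fin p)) :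
    Matrix (Fin n) (Fin n) ℝ :=
  projMat ((1 - proj X (τ \ Λ)) * subcols X (Λ ∩ τ))

/-- The nuclear mapping `T̃(y, (β_Λ, τ))` with values in `EReal` (it takes the value
`⊤ = +∞` when `β_i ≠ 0` for some `i ∈ Λ ∖ τ`). -/
def Tnuc {n p : ℕ} (X : Matrix (Fin n) (Fin p) ℝ) (Λ τ : Finset (Fin p))
    (β : Fin p → ℝ) (y : Fin n → ℝ) : EReal :=
  if ∃ i ∈ Λ \ τ, β i ≠ 0 then ⊤
  else if Λ ∩ τ = ∅ then 0
  else ((((y - X.mulVec (maskOn Λ β)) ⬝ᵥ (projO X τ Λ).mulVec (y - X.mulVec (maskOn Λ β))) /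
    (((y - X.mulVec (maskOn Λ β)) ⬝ᵥ (1 - proj X τ).mulVec (y - X.mulVec (maskOn Λ β))) /
      ((n : ℝ) - τ.card)) : ℝ) : EReal)

/-- The statistic `u ↦ (uᵀ O_{τ,Λ} u)/(uᵀ(I−H_τ)u/(n−|τ|))`. -/
def fstat {n p : ℕ} (X : Matrix (Fin n) (Fin p) ℝ) (τ Λ : Finset (Fin p))
    (u : Fin n → ℝ) : ℝ :=
  (u ⬝ᵥ (projO X τ Λ).mulVec u) / ((u ⬝ᵥ (1 - proj X τ).mulVec u) / ((n : ℝ) - τ.card))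

/-- The `α`-quantile `q_α(τ, Λ)` of the law of `fstat` under `N(0, I_n)`. -/
def qant {n p : ℕ} (X : Matrix (Fin n) (Fin p) ℝ) (τ Λ : Finset (Fin p)) (α : ℝ) : ℝ :=
  sInf {x : ℝ | α ≤ (((stdGaussian n).map (fstat X τ Λ)) (Set.Iic x)).toReal}



lemma lint_gauss (α : ℝ) (hα : α < 1/2) :
    ∫⁻ x, ENNReal.ofReal (Real.exp (α * x ^ 2)) ∂(gaussianReal 0 1) =
      ENNReal.ofReal ((Real.sqrt (1 - 2 * α))⁻¹) := by
  rw [gaussianReal_of_var_ne_zero _ one_ne_zero,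
    lintegral_withDensity_eq_lintegral_mul _ (measurable_gaussianPDF 0 1) (by fun_prop)]
  have hb : 0 < 1/2 - α := by linarith
  have h1 : ∀ x : ℝ, (gaussianPDF 0 1 * fun x => ENNReal.ofReal (Real.exp (α * x ^ 2))) x
      = ENNReal.ofReal ((Real.sqrt (2 * Real.pi))⁻¹ * Real.exp (-(1/2 - α) * x ^ 2)) := by
    intro x
    simp only [Pi.mul_apply, gaussianPDF, gaussianPDFReal]
    rw [← ENNReal.ofReal_mul (by positivity), mul_assoc, ← Real.exp_add]
    congr 3
    · simp
    · simp; ring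
  simp_rw [h1]
  rw [← ofReal_integral_eq_lintegral_ofReal ((integrable_exp_neg_mul_sq hb).const_mul _)
    (ae_of_all _ fun x => by positivity), integral_const_mul, integral_gaussian]
  congr 1
  rw [← Real.sqrt_inv, ← Real.sqrt_inv, ← Real.sqrt_mul (by positivity)]
  congr 1
  have := Real.pi_pos
  have h2 : 1 - 2 * α ≠ 0 := by linarith
  have h3 : (1/2 - α) ≠ 0 := by linarith
  field_simp
  

lemma lint_pi {ι : Type*} [Fintype ι] (α : ℝ) (hα : α < 1/2) (S : Finset ι) :
    ∫⁻ x, ENNReal.ofReal (Real.exp (α * ∑ i ∈ S, x i ^ 2))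
      ∂(Measure.pi fun _ : ι => gaussianReal 0 1) =
      ENNReal.ofReal ((Real.sqrt (1 - 2 * α))⁻¹) ^ S.card := by
  have h1 : ∀ x : ι → ℝ, ENNReal.ofReal (Real.exp (α * ∑ i ∈ S, x i ^ 2))
      = ∏ i ∈ S, ENNReal.ofReal (Real.exp (α * (x i) ^ 2)) := by
    intro x
    rw [Finset.mul_sum, Real.exp_sum, ENNReal.ofReal_prod_of_nonneg (fun i _ => by positivity)]
  simp_rw [h1]
  have hi := iIndepFun_pi (μ := fun _ : ι => gaussianReal 0 1)
    (X := fun _ y => ENNReal.ofReal (Real.exp (α * y ^ 2))) (fun i => by fun_prop)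
  rw [lintegral_prod_eq_prod_lintegral_of_indepFun S _ hi (fun i => by fun_prop)]
  rw [← Finset.prod_const]
  refine Finset.prod_congr rfl fun i _ => ?_
  rw [← lint_gauss α hα]
  rw [← (measurePreserving_eval (fun _ : ι => gaussianReal 0 1) i).lintegral_comp (by fun_prop)]

lemma tail_one (r : ℝ) :
    gaussianReal 0 1 {a : ℝ | r < a ^ 2} ≤ ENNReal.ofReal (2 * Real.exp (-r / 2)) := by
  rcases le_or_gt r 0 with hr | hr
  · refine prob_le_one.trans ?_
    rw [ENNReal.one_le_ofReal]
    have : 1 ≤ Real.exp (-r/2) := Real.one_le_exp (by linarith)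
    linarith
  have hs : 0 < Real.sqrt r := Real.sqrt_pos.2 hr
  have hss := Real.sq_sqrt hr.le
  have key : ∀ (X : ℝ → ℝ), (gaussianReal 0 1).map X = gaussianReal 0 1 →
      Integrable (fun x => Real.exp (Real.sqrt r * X x)) (gaussianReal 0 1) →
      gaussianReal 0 1 {a : ℝ | Real.sqrt r ≤ X a} ≤ ENNReal.ofReal (Real.exp (-r / 2)) := by
    intro X hX hint
    have := measure_ge_le_exp_mul_mgf (μ := gaussianReal 0 1) (X := X) (Real.sqrt r) hs.le hint
    rw [mgf_gaussianReal hX] at this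
    rw [← ofReal_measureReal]
    refine ENNReal.ofReal_le_ofReal (this.trans ?_)
    rw [← Real.exp_add, Real.exp_le_exp]
    simp; nlinarith
  have hsub : {a : ℝ | r < a ^ 2} ⊆ {a | Real.sqrt r ≤ a} ∪ {a | Real.sqrt r ≤ -a} := by
    intro a ha
    have : Real.sqrt r < |a| := by
      rw [Real.sqrt_lt' (by by_contra h; have : a = 0 := by simpa using h
                            subst this; simp at ha; linarith)]
      simpa using ha
    rcases lt_abs.1 this with h | h
    · left; exact h.le
    · right; exact h.le
  refine (measure_mono hsub).trans ((measure_union_le _ _).trans ?_)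
  rw [two_mul, ENNReal.ofReal_add (by positivity) (by positivity)]
  gcongr
  · exact key (fun a => a) (by simp) (integrable_exp_mul_gaussianReal _)
  · refine key (fun a => -a) (by rw [gaussianReal_map_neg]; simp) ?_
    simpa using (integrable_exp_mul_gaussianReal (μ := 0) (v := 1) (-Real.sqrt r))

lemma cap_pi {ι : Type*} [Fintype ι] (S : Finset ι) (i0 : ι) (hi : i0 ∉ S) (c : ℝ) (hc : 0 ≤ c) :
    (Measure.pi fun _ : ι => gaussianReal 0 1) {x : ι → ℝ | c * ∑ i ∈ S, x i ^ 2 < x i0 ^ 2}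
      ≤ 2 * ENNReal.ofReal ((Real.sqrt (1 + c))⁻¹) ^ S.card := by
  set P := (Measure.pi fun _ : ι => gaussianReal 0 1) with hP
  have hind := (iIndepFun_pi (μ := fun _ : ι => gaussianReal 0 1) (X := fun _ y => y)
    (fun i => by fun_prop)).indepFun_finset {i0} S (by simpa using hi) (fun i => by fun_prop)
  have hind2 : IndepFun (fun x : ι → ℝ => x i0) (fun x : ι → ℝ => ∑ i ∈ S, x i ^ 2) P := by
    have m1 : Measurable (fun y : (({i0} : Finset ι) → ℝ) => y ⟨i0, by simp⟩) :=
      measurable_pi_apply (⟨i0, by simp⟩ : ({i0} : Finset ι))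
    have m2 : Measurable (fun y : (S → ℝ) => ∑ i, y i ^ 2) := by fun_prop
    have := hind.comp m1 m2
    have e2 : (fun x : ι → ℝ => ∑ i ∈ S, x i ^ 2) =
        (fun y : (S → ℝ) => ∑ i, y i ^ 2) ∘ fun (x : ι → ℝ) (i : S) => x i := by
      funext x
      exact (Finset.sum_coe_sort S (fun i => x i ^ 2)).symm
    rw [e2]
    exact this
  have hZ : Measurable (fun x : ι → ℝ => ∑ i ∈ S, x i ^ 2) := by fun_prop
  have hm := hind2.map_prod_eq_prod_map_map (measurable_pi_apply _).aemeasurable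
    hZ.aemeasurable
  have hR : MeasurableSet {q : ℝ × ℝ | c * q.2 < q.1 ^ 2} :=
    measurableSet_lt (by fun_prop) (by fun_prop)
  have h1 : P {x : ι → ℝ | c * ∑ i ∈ S, x i ^ 2 < x i0 ^ 2} =
      P.map (fun x : ι → ℝ => (x i0, ∑ i ∈ S, x i ^ 2)) {q : ℝ × ℝ | c * q.2 < q.1 ^ 2} := by
    rw [Measure.map_apply (by fun_prop) hR]; rfl
  have h2 : P.map (fun x : ι → ℝ => x i0) = gaussianReal 0 1 :=
    (measurePreserving_eval (fun _ : ι => gaussianReal 0 1) i0).map_eq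
  have : IsProbabilityMeasure (P.map (fun x : ι → ℝ => ∑ i ∈ S, x i ^ 2)) :=
    Measure.isProbabilityMeasure_map hZ.aemeasurable
  rw [h1, hm, h2, Measure.prod_apply_symm hR]
  calc _ ≤ ∫⁻ z, ENNReal.ofReal (2 * Real.exp (-(c * z) / 2))
          ∂(P.map (fun x : ι → ℝ => ∑ i ∈ S, x i ^ 2)) :=
        lintegral_mono fun z => tail_one (c * z)
    _ = ∫⁻ x, 2 * ENNReal.ofReal (Real.exp ((-c/2) * ∑ i ∈ S, x i ^ 2)) ∂P := by
        rw [lintegral_map (by fun_prop) (by fun_prop)]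
        refine lintegral_congr fun x => ?_
        rw [ENNReal.ofReal_mul (by norm_num)]
        congr 3
        · simp
        · ring
    _ = _ := by
        rw [lintegral_const_mul _ (by fun_prop), lint_pi _ (by linarith)]
        congr 5; ring
    _ ≤ _ := le_rfl

section geo
set_option linter.unusedSectionVars false
variable {E : Type*} [NormedAddCommGroup E] [InnerProductSpace ℝ E] [FiniteDimensional ℝ E]
  [MeasurableSpace E] [BorelSpace E]

lemma exists_basis (K : Submodule ℝ E) (T : Set E) (hT : T.Subsingleton)
    (hTe : ∀ e ∈ T, ‖e‖ = 1 ∧ ∀ x ∈ K, inner ℝ x e = 0) :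
    ∃ (u : Finset E) (b : OrthonormalBasis u ℝ E) (S : Finset u),
      S.card = Module.finrank ℝ K ∧ (∀ e ∈ T, ∃ i0, i0 ∉ S ∧ b i0 = e) ∧
      ∀ x, ‖K.starProjection x‖ ^ 2 = ∑ i ∈ S, (inner ℝ (b i) x) ^ 2 := by
  let bK := stdOrthonormalBasis ℝ K
  let v : Fin (Module.finrank ℝ K) → E := fun i => (bK i : E)
  have hv : Orthonormal ℝ v := bK.orthonormal.comp_linearIsometry K.subtypeₗᵢ
  have hvK : ∀ i, v i ∈ K := fun i => (bK i).2
  have horth : Orthonormal ℝ ((↑) : (Set.range v ∪ T : Set E) → E) := by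
    rw [orthonormal_subtype_iff_ite]
    have hr := orthonormal_subtype_iff_ite.1 hv.toSubtypeRange
    have hne : ∀ i, ∀ e ∈ T, v i ≠ e := by
      intro i e he h
      have h1 := (hTe e he).2 _ (hvK i)
      have h2 := (hTe e he).1
      rw [h, real_inner_self_eq_norm_sq, h2] at h1
      norm_num at h1
    rintro a (ha | ha) c (hc | hc)
    · exact hr a ha c hc
    · obtain ⟨i, rfl⟩ := ha
      rw [if_neg (hne i c hc)]
      exact (hTe c hc).2 _ (hvK i)
    · obtain ⟨i, rfl⟩ := hc
      rw [if_neg (hne i a ha).symm, real_inner_comm]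
      exact (hTe a ha).2 _ (hvK i)
    · rw [if_pos (hT ha hc), hT hc ha, real_inner_self_eq_norm_sq, (hTe a ha).1]
      norm_num
  obtain ⟨u, b, hu, hb⟩ := horth.exists_orthonormalBasis_extension
  have hmem : ∀ i, v i ∈ u := fun i => hu (Or.inl ⟨i, rfl⟩)
  let f : Fin (Module.finrank ℝ K) → u := fun i => ⟨v i, hmem i⟩
  have hf : Function.Injective f := by
    intro i j hij
    have h2 : v i = v j := by
      have h3 : ((f i : u) : E) = ((f j : u) : E) := by rw [hij]
      exact h3
    exact hv.linearIndependent.injective h2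
  refine ⟨u, b, Finset.univ.image f, ?_, ?_, ?_⟩
  · rw [Finset.card_image_of_injective _ hf]; simp
  · intro e he
    refine ⟨⟨e, hu (Or.inr he)⟩, ?_, by rw [hb]⟩
    intro h
    obtain ⟨i, -, hi⟩ := Finset.mem_image.1 h
    have hi : v i = e := congrArg Subtype.val hi
    have h1 := (hTe e he).2 _ (hvK i)
    rw [hi, real_inner_self_eq_norm_sq, (hTe e he).1] at h1
    norm_num at h1
  · intro x
    rw [Finset.sum_image (fun i _ j _ h => hf h)]
    have h1 : ‖K.starProjection x‖ ^ 2 = ‖K.orthogonalProjectionOnto x‖ ^ 2 := by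
      rfl
    rw [h1, ← bK.sum_sq_inner_right]
    refine Finset.sum_congr rfl fun i _ => ?_
    rw [hb]
    congr 1
    show inner ℝ (bK i) _ = inner ℝ (bK i : E) x
    rw [Submodule.inner_orthogonalProjectionOnto_eq_of_mem_left]

lemma stdG_apply {ι : Type*} [Fintype ι] (b : OrthonormalBasis ι ℝ E) (s : Set E)
    (hs : MeasurableSet s) :
    ProbabilityTheory.stdGaussian E s =
      (Measure.pi fun _ : ι => gaussianReal 0 1) {x | ∑ i, x i • b i ∈ s} := by
  rw [stdGaussian_eq_map_pi_orthonormalBasis b, Measure.map_apply (by fun_prop) hs]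
  rfl

lemma inner_sum_basis {ι : Type*} [Fintype ι] (b : OrthonormalBasis ι ℝ E) (x : ι → ℝ) (j : ι) :
    inner ℝ (b j) (∑ i, x i • b i) = x j := by
  simp [inner_sum, real_inner_smul_right, b.inner_eq_ite]

lemma chi_bound (K : Submodule ℝ E) (k : ℕ) (hk : Module.finrank ℝ K ≤ k) (x : ℝ) :
    ProbabilityTheory.stdGaussian E {u | x ≤ ‖K.starProjection u‖ ^ 2} ≤
      ENNReal.ofReal (Real.exp (-x / 3) * Real.sqrt 3 ^ k) := by
  obtain ⟨w, b, S, hS, -, hn⟩ := exists_basis K ∅ (by simp) (by simp)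
  rw [stdG_apply b _ (measurableSet_le (by fun_prop) (by fun_prop))]
  have h0 : {y : w → ℝ | ∑ i, y i • b i ∈ {u | x ≤ ‖K.starProjection u‖ ^ 2}} =
      {y | ENNReal.ofReal (Real.exp (x/3)) ≤
        ENNReal.ofReal (Real.exp ((1/3) * ∑ i ∈ S, y i ^ 2))} := by
    ext y
    simp only [Set.mem_ofPred_eq, hn, inner_sum_basis]
    rw [ENNReal.ofReal_le_ofReal_iff (by positivity), Real.exp_le_exp]
    constructor <;> intro h <;> linarith
  rw [h0]
  have hmk := meas_ge_le_lintegral_div (μ := Measure.pi fun _ : w => gaussianReal 0 1)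
    (f := fun y => ENNReal.ofReal (Real.exp ((1/3) * ∑ i ∈ S, y i ^ 2)))
    (Measurable.aemeasurable (by fun_prop)) (ε := ENNReal.ofReal (Real.exp (x/3)))
    (by simpa using Real.exp_pos _) (by simp)
  refine hmk.trans ?_
  rw [lint_pi _ (by norm_num), ← ENNReal.ofReal_pow (by positivity),
    ← ENNReal.ofReal_div_of_pos (by positivity)]
  refine ENNReal.ofReal_le_ofReal ?_
  have h3 : (Real.sqrt (1 - 2 * (1/3)))⁻¹ = Real.sqrt 3 := by
    rw [← Real.sqrt_inv]; norm_num
  rw [h3, div_eq_mul_inv, ← Real.exp_neg, mul_comm, neg_div]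
  gcongr
  · rw [Real.one_le_sqrt]; norm_num
  · omega

lemma cap_bound (K : Submodule ℝ E) (e : E) (he : ‖e‖ = 1) (heK : ∀ x ∈ K, inner ℝ x e = 0)
    (c : ℝ) (hc : 0 ≤ c) :
    ProbabilityTheory.stdGaussian E
      {u | c * ‖K.starProjection u‖ ^ 2 < (inner ℝ e u) ^ 2} ≤
      2 * ENNReal.ofReal ((Real.sqrt (1 + c))⁻¹) ^ (Module.finrank ℝ K) := by
  obtain ⟨w, b, S, hS, hb, hn⟩ := exists_basis K {e} (by simp)
    (by intro e' he'; obtain rfl : e' = e := he'; exact ⟨he, heK⟩)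
  obtain ⟨i0, hi0, hbe⟩ := hb e rfl
  rw [stdG_apply b _ (measurableSet_lt (by fun_prop) (by fun_prop)), ← hS]
  have h0 : {y : w → ℝ | ∑ i, y i • b i ∈
      {u | c * ‖K.starProjection u‖ ^ 2 < (inner ℝ e u) ^ 2}} =
      {y | c * ∑ i ∈ S, y i ^ 2 < y i0 ^ 2} := by
    ext y
    simp only [Set.mem_ofPred_eq, hn, ← hbe, inner_sum_basis]
  rw [h0]
  exact cap_pi S i0 hi0 c hc

lemma lin_bound (w : E) (σ : ℝ) (hσ : 0 < σ) :
    ProbabilityTheory.stdGaussian E {u | ‖w‖ ^ 2 / (3 * σ) ≤ inner ℝ (-w) u} ≤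
      ENNReal.ofReal (Real.exp (-(‖w‖ ^ 2) / (18 * σ ^ 2))) := by
  have hL : (ProbabilityTheory.stdGaussian E).map (fun u => inner ℝ (-w) u) =
      gaussianReal 0 (‖w‖₊ ^ 2) := by
    have := IsGaussian.map_eq_gaussianReal (μ := ProbabilityTheory.stdGaussian E)
      (innerSL ℝ (-w))
    rw [integral_strongDual_stdGaussian, variance_dual_stdGaussian] at this
    simp only [innerSL_apply_norm, norm_neg] at this
    convert this using 2
    · ext; simp
    · rw [Real.toNNReal_pow (norm_nonneg _), norm_toNNReal]
  have hint : Integrable (fun u => Real.exp (1/(3*σ) * inner ℝ (-w) u))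
      (ProbabilityTheory.stdGaussian E) := by
    have := integrable_exp_mul_gaussianReal (μ := 0) (v := ‖w‖₊ ^ 2) (1/(3*σ))
    rw [← hL, integrable_map_measure (by fun_prop) (by fun_prop)] at this
    exact this
  have := measure_ge_le_exp_mul_mgf (μ := ProbabilityTheory.stdGaussian E)
    (X := fun u => inner ℝ (-w) u) (t := 1/(3*σ)) (‖w‖ ^ 2 / (3 * σ)) (by positivity) hint
  rw [mgf_gaussianReal hL] at this
  rw [← ofReal_measureReal]
  refine ENNReal.ofReal_le_ofReal (this.trans ?_)
  rw [← Real.exp_add, Real.exp_le_exp]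
  apply le_of_eq
  simp
  field_simp
  ring
end geo

section geo2
variable {E : Type*} [NormedAddCommGroup E] [InnerProductSpace ℝ E] [FiniteDimensional ℝ E]

lemma star_orth (V : Submodule ℝ E) (x : E) :
    Vᗮ.starProjection x = x - V.starProjection x := by
  rw [Submodule.starProjection_orthogonal]; simp

lemma proj_diff (V W : Submodule ℝ E) (h : V ≤ W) (x : E) :
    ‖W.starProjection x‖ ^ 2 = ‖V.starProjection x‖ ^ 2 +
      ‖(Vᗮ ⊓ W).starProjection x‖ ^ 2 := by
  have h1 : V.starProjection (W.starProjection x) = V.starProjection x := by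
    have h2 : x - W.starProjection x ∈ Vᗮ :=
      Submodule.orthogonal_le h (Submodule.sub_starProjection_mem_orthogonal x)
    have := (Submodule.starProjection_apply_eq_zero_iff V).2 h2
    rw [map_sub, sub_eq_zero] at this
    exact this.symm
  have h3 : (Vᗮ ⊓ W).starProjection x = Vᗮ.starProjection (W.starProjection x) := by
    rw [star_orth, h1]
    refine Submodule.eq_starProjection_of_mem_of_inner_eq_zero ⟨?_, ?_⟩ ?_
    · rw [← h1]; exact Submodule.sub_starProjection_mem_orthogonal _
    · exact W.sub_mem (Submodule.starProjection_apply_mem _ _)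
        (h (Submodule.starProjection_apply_mem _ _))
    · intro y hy
      have e : x - (W.starProjection x - V.starProjection x) =
        (x - W.starProjection x) + V.starProjection x := by abel
      rw [e, inner_add_left]
      rw [Submodule.starProjection_inner_eq_zero _ _ hy.2]
      have : y ∈ Vᗮ := hy.1
      rw [Submodule.mem_orthogonal] at this
      rw [this _ (Submodule.starProjection_apply_mem _ _), add_zero]
  rw [h3, Submodule.norm_sq_eq_add_norm_sq_starProjection (W.starProjection x) V, h1]

lemma resid_sq (W : Submodule ℝ E) (x : E) :
    ‖x - W.starProjection x‖ ^ 2 = ‖x‖ ^ 2 - ‖W.starProjection x‖ ^ 2 := by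
  rw [Submodule.norm_sq_eq_add_norm_sq_starProjection x W,
    star_orth]
  ring

lemma resid_mem (W : Submodule ℝ E) (μ U : E) (σ : ℝ) (h : μ ∈ W) :
    ‖(μ + σ • U) - W.starProjection (μ + σ • U)‖ ^ 2 =
      σ ^ 2 * (‖U‖ ^ 2 - ‖W.starProjection U‖ ^ 2) := by
  rw [← resid_sq, map_add, map_smul, Submodule.starProjection_eq_self_iff.2 h,
    add_sub_add_left_eq_sub, ← smul_sub, norm_smul, mul_pow, Real.norm_eq_abs, sq_abs]

lemma large_fail (W W0 W' : Submodule ℝ E) (h0 : W0 ≤ W') (h1 : W ≤ W') (μ U : E) (σ : ℝ)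
    (hμ : μ ∈ W0) (A B : ℝ)
    (h : ‖(μ + σ • U) - W.starProjection (μ + σ • U)‖ ^ 2 + A ≤
      ‖(μ + σ • U) - W0.starProjection (μ + σ • U)‖ ^ 2 + B) :
    A - B ≤ σ ^ 2 * ‖(W0ᗮ ⊓ W').starProjection U‖ ^ 2 := by
  have e1 := resid_mem W' μ U σ (h0 hμ)
  have e2 := resid_mem W0 μ U σ hμ
  rw [resid_sq] at e1 h
  have e3 := proj_diff W W' h1 (μ + σ • U)
  have e4 := proj_diff W0 W' h0 U
  rw [e4] at e1
  have := sq_nonneg ‖(Wᗮ ⊓ W').starProjection (μ + σ • U)‖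
  nlinarith

lemma small_fail (W W0 Wc : Submodule ℝ E) (h0 : Wc ≤ W0) (h1 : Wc ≤ W) (μ U : E) (σ : ℝ)
    (hσ : 0 < σ) (hμ : μ ∈ W0) (A B : ℝ)
    (hAB : B - A ≤ ‖μ - W.starProjection μ‖ ^ 2 / 6)
    (h : ‖(μ + σ • U) - W.starProjection (μ + σ • U)‖ ^ 2 + A ≤
      ‖(μ + σ • U) - W0.starProjection (μ + σ • U)‖ ^ 2 + B) :
    ‖μ - W.starProjection μ‖ ^ 2 / (3 * σ) ≤ inner ℝ (-(μ - W.starProjection μ)) U ∨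
    ‖μ - W.starProjection μ‖ ^ 2 / (6 * σ ^ 2) ≤ ‖(Wcᗮ ⊓ W).starProjection U‖ ^ 2 := by
  set w := μ - W.starProjection μ with hw
  have e2 := resid_mem W0 μ U σ hμ
  have e3 := proj_diff Wc W h1 U
  have e4 := proj_diff Wc W0 h0 U
  have e5 := sq_nonneg ‖(Wcᗮ ⊓ W0).starProjection U‖
  have e1 : ‖(μ + σ • U) - W.starProjection (μ + σ • U)‖ ^ 2 =
      ‖w‖ ^ 2 + 2 * σ * inner ℝ w U + σ ^ 2 * (‖U‖ ^ 2 - ‖W.starProjection U‖ ^ 2) := by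
    have : (μ + σ • U) - W.starProjection (μ + σ • U) = w + σ • (U - W.starProjection U) := by
      rw [map_add, map_smul, hw, smul_sub]; abel
    rw [this, norm_add_sq_real, norm_smul, mul_pow, Real.norm_eq_abs, sq_abs, resid_sq W U,
      real_inner_smul_right, inner_sub_right,
      Submodule.starProjection_inner_eq_zero μ _ (Submodule.starProjection_apply_mem _ _)]
    ring
  by_contra! hcon
  obtain ⟨c1, c2⟩ := hcon
  rw [lt_div_iff₀ (by positivity), inner_neg_left] at c1
  rw [lt_div_iff₀ (by positivity)] at c2
  rw [e1, e2, e3, e4] at h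
  have := mul_nonneg (sq_nonneg σ) e5
  nlinarith

lemma good_angle (V : Submodule ℝ E) (μ u : E) (γ : ℝ)
    (h : (inner ℝ u (μ - V.starProjection μ)) ^ 2 ≤
      γ ^ 2 * ‖Vᗮ.starProjection u‖ ^ 2 * ‖μ - V.starProjection μ‖ ^ 2) :
    (1 - γ ^ 2) * ‖μ - V.starProjection μ‖ ^ 2 ≤
      ‖μ - (V ⊔ Submodule.span ℝ {u}).starProjection μ‖ ^ 2 := by
  set W := V ⊔ Submodule.span ℝ {u}
  set v := μ - V.starProjection μ with hv
  obtain ⟨a, ha, b, hb, hz⟩ := Submodule.mem_sup.1 (Submodule.starProjection_apply_mem W μ)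
  obtain ⟨c, rfl⟩ := Submodule.mem_span_singleton.1 hb
  have h1 : Vᗮ.starProjection (μ - W.starProjection μ) = v - c • Vᗮ.starProjection u := by
    rw [← hz, map_sub, map_add, map_smul, star_orth V μ,
      (Submodule.starProjection_apply_eq_zero_iff Vᗮ).2 (by simpa using ha), zero_add]
  have h2 : ‖v - c • Vᗮ.starProjection u‖ ^ 2 ≤ ‖μ - W.starProjection μ‖ ^ 2 := by
    rw [← h1]
    gcongr
    exact Submodule.norm_starProjection_apply_le _ _
  refine le_trans ?_ h2
  have hvm : v ∈ Vᗮ := Submodule.sub_starProjection_mem_orthogonal μ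
  have h3 : inner ℝ v (Vᗮ.starProjection u) = inner ℝ u v := by
    rw [← Submodule.inner_starProjection_left_eq_right,
      Submodule.starProjection_eq_self_iff.2 hvm, real_inner_comm]
  rw [norm_sub_sq_real v, real_inner_smul_right, h3, norm_smul, mul_pow, Real.norm_eq_abs, sq_abs]
  set i := inner ℝ u v
  set P := ‖Vᗮ.starProjection u‖ ^ 2
  set Q := ‖v‖ ^ 2
  have hP : 0 ≤ P := by positivity
  have hQ : 0 ≤ Q := by positivity
  have h4 : (2 * (c * i)) ^ 2 ≤ (γ ^ 2 * Q + c ^ 2 * P) ^ 2 := by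
    have : c ^ 2 * i ^ 2 ≤ c ^ 2 * (γ ^ 2 * P * Q) := by gcongr
    nlinarith [sq_nonneg (γ ^ 2 * Q - c ^ 2 * P)]
  have h5 := abs_le_of_sq_le_sq h4 (by positivity)
  linarith [(abs_le.1 h5).2]

variable [MeasurableSpace E] [BorelSpace E]

lemma angle_bound (V : Submodule ℝ E) (μ : E) (γ : ℝ) (h0 : 0 < γ) (h1 : γ < 1)
    (hθ : Real.arccos γ ≤ 1) (N : ℕ) (hN : N + 1 ≤ Module.finrank ℝ Vᗮ) :
    ProbabilityTheory.stdGaussian E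
      {u | γ ^ 2 * ‖Vᗮ.starProjection u‖ ^ 2 * ‖μ - V.starProjection μ‖ ^ 2
        < (inner ℝ u (μ - V.starProjection μ)) ^ 2}
      ≤ ENNReal.ofReal (2 * Real.arccos γ ^ N) := by
  set v := μ - V.starProjection μ with hv
  rcases eq_or_ne v 0 with hv0 | hv0
  · simp [hv0]
  have hvm : v ∈ Vᗮ := Submodule.sub_starProjection_mem_orthogonal μ
  have hvn : 0 < ‖v‖ := norm_pos_iff.2 hv0
  set e := (‖v‖)⁻¹ • v with he
  have hen : ‖e‖ = 1 := by
    rw [he, norm_smul, norm_inv, norm_norm, inv_mul_cancel₀ hvn.ne']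
  have hve : v = ‖v‖ • e := by rw [he, smul_smul, mul_inv_cancel₀ hvn.ne', one_smul]
  have hem : e ∈ Vᗮ := Submodule.smul_mem _ _ hvm
  set S := Submodule.span ℝ {e}
  have hS : S ≤ Vᗮ := by rw [Submodule.span_singleton_le_iff_mem]; exact hem
  have hg : 0 < 1 - γ ^ 2 := by nlinarith
  have hsub : {u | γ ^ 2 * ‖Vᗮ.starProjection u‖ ^ 2 * ‖v‖ ^ 2 < (inner ℝ u v) ^ 2} ⊆
      {u | γ ^ 2 / (1 - γ ^ 2) * ‖(Sᗮ ⊓ Vᗮ).starProjection u‖ ^ 2 < (inner ℝ e u) ^ 2} := by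
    intro u hu
    simp only [Set.mem_ofPred_eq] at hu ⊢
    rw [proj_diff S Vᗮ hS, Submodule.starProjection_unit_singleton ℝ hen, norm_smul, hen, mul_one,
      Real.norm_eq_abs, sq_abs] at hu
    have e1 : inner ℝ u v = ‖v‖ * inner ℝ e u := by
      conv_lhs => rw [hve]
      rw [real_inner_smul_right, real_inner_comm]
    rw [e1, mul_pow, mul_comm] at hu
    have := lt_of_mul_lt_mul_left hu (by positivity)
    rw [div_mul_eq_mul_div, div_lt_iff₀ hg]
    nlinarith
  refine (measure_mono hsub).trans ?_
  refine (cap_bound (Sᗮ ⊓ Vᗮ) e hen ?_ _ (by positivity)).trans ?_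
  · intro x hx
    rw [real_inner_comm]
    exact (Submodule.mem_orthogonal _ _).1 hx.1 e (Submodule.mem_span_singleton_self e)
  have hd := Submodule.finrank_add_inf_finrank_orthogonal hS
  have hS1 : Module.finrank ℝ S = 1 := finrank_span_singleton (by
    intro h; rw [h] at hen; simp at hen)
  have hs : (Real.sqrt (1 + γ ^ 2 / (1 - γ ^ 2)))⁻¹ ≤ Real.arccos γ := by
    have : 1 + γ ^ 2 / (1 - γ ^ 2) = (1 - γ ^ 2)⁻¹ := by field_simp; ring
    rw [this, Real.sqrt_inv, inv_inv, ← Real.sin_arccos]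
    exact Real.sin_le (Real.arccos_nonneg _)
  rw [ENNReal.ofReal_mul (by norm_num), ENNReal.ofReal_ofNat,
    ← ENNReal.ofReal_pow (by positivity)]
  gcongr 2 * ENNReal.ofReal ?_
  calc _ ≤ Real.arccos γ ^ (Module.finrank ℝ ↥(Sᗮ ⊓ Vᗮ)) := by gcongr
    _ ≤ _ := pow_le_pow_of_le_one (Real.arccos_nonneg _) hθ (by omega)

end geo2

lemma sum_models {p : ℕ} (τ₀ : Finset (Fin p)) (f : ℕ → ℕ → ℝ) :
    ∑ τ : Finset (Fin p), f (τ₀ \ τ).card (τ \ τ₀).card =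
      ∑ m ∈ Finset.range (τ₀.card + 1), (τ₀.card.choose m : ℝ) *
        ∑ k ∈ Finset.range (p - τ₀.card + 1), ((p - τ₀.card).choose k : ℝ) * f m k := by
  have hc : (τ₀ᶜ).card = p - τ₀.card := by rw [Finset.card_compl, Fintype.card_fin]
  have h1 : ∑ τ : Finset (Fin p), f (τ₀ \ τ).card (τ \ τ₀).card =
      ∑ q ∈ τ₀.powerset ×ˢ (τ₀ᶜ).powerset, f q.1.card q.2.card := by
    refine Finset.sum_nbij' (fun τ => (τ₀ \ τ, τ \ τ₀)) (fun q => (τ₀ \ q.1) ∪ q.2) ?_ ?_ ?_ ?_ ?_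
    · intro τ _
      simp only [Finset.mem_product, Finset.mem_powerset]
      refine ⟨Finset.sdiff_subset, ?_⟩
      intro x hx
      simp only [Finset.mem_sdiff] at hx
      simpa using hx.2
    · intro q _; simp
    · intro τ _
      ext x
      simp only [Finset.mem_union, Finset.mem_sdiff]
      tauto
    · rintro ⟨B, A⟩ hq
      simp only [Finset.mem_product, Finset.mem_powerset] at hq
      obtain ⟨hB, hA⟩ := hq
      have hA' : ∀ x ∈ A, x ∉ τ₀ := fun x hx => by simpa using hA hx
      ext x
      · have := @hB x
        have := hA' x
        simp only [Finset.mem_union, Finset.mem_sdiff]; tauto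
      · have := @hB x
        have := hA' x
        simp only [Finset.mem_union, Finset.mem_sdiff]; tauto
    · intro τ _; rfl
  rw [h1, Finset.sum_product]
  have h2 : ∀ m, ∑ y ∈ (τ₀ᶜ).powerset, f m y.card =
      ∑ k ∈ Finset.range (p - τ₀.card + 1), ((p - τ₀.card).choose k : ℝ) * f m k := by
    intro m
    rw [Finset.sum_powerset_apply_card (fun k => f m k), hc]
    simp
  simp_rw [h2]
  rw [Finset.sum_powerset_apply_card (fun m => ∑ k ∈ Finset.range (p - τ₀.card + 1),
    ((p - τ₀.card).choose k : ℝ) * f m k)]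
  simp

lemma binom_le (r m N : ℕ) :
    ∑ k ∈ Finset.range N, (if k ≤ m then (r.choose k : ℝ) else 0) ≤ (1 + r : ℝ) ^ m := by
  calc _ = ∑ k ∈ (Finset.range N).filter (· ≤ m), (r.choose k : ℝ) := by
        rw [Finset.sum_filter]
    _ ≤ ∑ k ∈ Finset.range (m + 1), (r.choose k : ℝ) := by
        refine Finset.sum_le_sum_of_subset_of_nonneg ?_ (fun _ _ _ => by positivity)
        intro k hk
        simp only [Finset.mem_filter, Finset.mem_range] at hk ⊢
        omega
    _ ≤ ∑ k ∈ Finset.range (m + 1), (r : ℝ) ^ k * 1 ^ (m - k) * (m.choose k : ℝ) := by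
        refine Finset.sum_le_sum fun k hk => ?_
        simp only [Finset.mem_range] at hk
        have h1 : (r.choose k : ℝ) ≤ (r : ℝ) ^ k := by exact_mod_cast Nat.choose_le_pow r k
        have h2 : (1 : ℝ) ≤ (m.choose k : ℝ) := by
          exact_mod_cast Nat.choose_pos (by omega)
        rw [one_pow, mul_one]
        nlinarith [pow_nonneg (Nat.cast_nonneg (α := ℝ) r) k]
    _ = (1 + r : ℝ) ^ m := by rw [← add_pow, add_comm]

lemma small_sum {p : ℕ} (τ₀ : Finset (Fin p)) (hs : 1 ≤ τ₀.card) (z : ℝ) (hz : 0 ≤ z)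
    (hz6 : 6 * (p : ℝ) ^ 2 * z ≤ 1) :
    ∑ τ : Finset (Fin p), (if 1 ≤ (τ₀ \ τ).card ∧ (τ \ τ₀).card ≤ (τ₀ \ τ).card then
      2 * (2 * z) ^ (τ₀ \ τ).card else 0) ≤ 6 * (p : ℝ) ^ 2 * z := by
  rw [sum_models τ₀ (fun m k => if 1 ≤ m ∧ k ≤ m then 2 * (2 * z) ^ m else 0)]
  set s := τ₀.card with hsdef
  have hsp : s ≤ p := by simpa using Finset.card_le_univ τ₀
  set r := p - s with hr
  set x := 2 * (p : ℝ) ^ 2 * z with hx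
  have hx0 : 0 ≤ x := by positivity
  have hx3 : x ≤ 1/3 := by linarith
  have h1 : ∀ m ∈ Finset.range (s + 1), (s.choose m : ℝ) *
      ∑ k ∈ Finset.range (r + 1), (r.choose k : ℝ) *
        (if 1 ≤ m ∧ k ≤ m then 2 * (2 * z) ^ m else 0) ≤ if 1 ≤ m then 2 * x ^ m else 0 := by
    intro m _
    by_cases hm : 1 ≤ m
    · simp only [hm, true_and, if_true]
      have e1 : ∑ k ∈ Finset.range (r + 1), (r.choose k : ℝ) *
          (if k ≤ m then 2 * (2 * z) ^ m else 0) =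
          (∑ k ∈ Finset.range (r + 1), (if k ≤ m then (r.choose k : ℝ) else 0)) *
            (2 * (2 * z) ^ m) := by
        rw [Finset.sum_mul]
        refine Finset.sum_congr rfl fun k _ => ?_
        split_ifs <;> simp
      rw [e1]
      have e2 := binom_le r m (r + 1)
      have e3 : (s.choose m : ℝ) ≤ (s : ℝ) ^ m := by exact_mod_cast Nat.choose_le_pow s m
      have e4 : (s : ℝ) * (1 + r) ≤ (p : ℝ) ^ 2 := by
        have a1 : (s : ℝ) ≤ p := by exact_mod_cast hsp
        have a2 : (1 + r : ℝ) ≤ p := by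
          have : 1 + r ≤ p := by omega
          exact_mod_cast this
        rw [sq]; gcongr
      calc _ ≤ (s : ℝ) ^ m * ((1 + r : ℝ) ^ m * (2 * (2 * z) ^ m)) := by gcongr
        _ = 2 * (((s : ℝ) * (1 + r)) * (2 * z)) ^ m := by
            rw [mul_pow ((s:ℝ) * (1 + r)), mul_pow (s:ℝ)]; ring
        _ ≤ 2 * ((p : ℝ) ^ 2 * (2 * z)) ^ m := by gcongr
        _ = _ := by rw [hx]; ring
    · simp [hm]
  refine (Finset.sum_le_sum h1).trans ?_
  rw [Finset.sum_range_succ']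
  simp only [Nat.le_add_left, if_true]
  rw [if_neg (by omega : ¬ (1:ℕ) ≤ 0), add_zero]
  have h2 : ∀ N : ℕ, ∑ m ∈ Finset.range N, 2 * x ^ (m + 1) ≤ 3 * x - 3 * x * x ^ N := by
    intro N
    induction N with
    | zero => simp
    | succ N ih =>
      rw [Finset.sum_range_succ]
      have : 0 ≤ x ^ (N+1) * (1/3 - x) := mul_nonneg (by positivity) (by linarith)
      have e : 3 * x * x ^ (N+1) = 3 * x * x^N * x := by ring
      have e' : x ^ (N+1) = x * x ^ N := by ring
      rw [e] 
      rw [e'] at this ⊢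
      nlinarith
  have := h2 s
  have h3 : 0 ≤ 3 * x * x ^ s := by positivity
  have h4 : 3 * x = 6 * (p : ℝ) ^ 2 * z := by rw [hx]; ring
  linarith

lemma large_sum {p : ℕ} (τ₀ : Finset (Fin p)) (hs : 1 ≤ τ₀.card) (h T : ℝ) (hh : 0 ≤ h)
    (hT : 0 ≤ T) (hle : h * (((p - τ₀.card : ℕ) : ℝ) * (τ₀.card : ℝ)) ≤ 9/10) :
    ∑ τ : Finset (Fin p), (if (τ₀ \ τ).card < (τ \ τ₀).card then
      T * h ^ (τ \ τ₀).card else 0) ≤ 3 * T := by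
  rw [sum_models τ₀ (fun m k => if m < k then T * h ^ k else 0)]
  set s := τ₀.card with hsdef
  set r := p - s with hr
  have hs1 : (1 : ℝ) ≤ s := by exact_mod_cast hs
  simp_rw [Finset.mul_sum]
  rw [Finset.sum_comm]
  have h1 : ∀ k ∈ Finset.range (r + 1), ∑ m ∈ Finset.range (s + 1), (s.choose m : ℝ) *
      ((r.choose k : ℝ) * (if m < k then T * h ^ k else 0)) ≤
      if 1 ≤ k then T / 2 * ((9/5) ^ k / (k.factorial : ℝ)) else 0 := by
    intro k _
    rcases k with _ | k
    · simp
    simp only [Nat.le_add_left, if_true]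
    have e1 : ∑ m ∈ Finset.range (s + 1), (s.choose m : ℝ) *
      ((r.choose (k+1) : ℝ) * (if m < k + 1 then T * h ^ (k+1) else 0)) =
      (∑ m ∈ Finset.range (s + 1), (if m ≤ k then (s.choose m : ℝ) else 0)) *
        ((r.choose (k+1) : ℝ) * (T * h ^ (k+1))) := by
      rw [Finset.sum_mul]
      refine Finset.sum_congr rfl fun m _ => ?_
      simp only [Nat.lt_succ_iff]
      split_ifs <;> simp
    rw [e1]
    have e2 := binom_le s k (s + 1)
    have e3 : (r.choose (k+1) : ℝ) ≤ (r : ℝ) ^ (k+1) / ((k+1).factorial : ℝ) :=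
      Nat.choose_le_pow_div (k+1) r
    have e4 : (1 + s : ℝ) ^ k ≤ 2 ^ k * (s : ℝ) ^ (k+1) := by
      calc (1 + s : ℝ) ^ k ≤ (2 * s) ^ k := by gcongr; linarith
        _ = 2 ^ k * (s : ℝ) ^ k := by rw [mul_pow]
        _ ≤ 2 ^ k * (s : ℝ) ^ (k+1) := by
            gcongr
            omega
    calc _ ≤ (2 ^ k * (s : ℝ) ^ (k+1)) *
          ((r : ℝ) ^ (k+1) / ((k+1).factorial : ℝ) * (T * h ^ (k+1))) := by
            gcongr
            exact e2.trans e4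
      _ = T / 2 * ((2 * (h * (r * s))) ^ (k+1) / ((k+1).factorial : ℝ)) := by
            rw [mul_pow, mul_pow, mul_pow, pow_succ 2 k]; ring
      _ ≤ T / 2 * ((9/5) ^ (k+1) / ((k+1).factorial : ℝ)) := by
            gcongr
            linarith
  refine (Finset.sum_le_sum h1).trans ?_
  rw [Finset.sum_range_succ']
  simp only [Nat.le_add_left, if_true]
  rw [if_neg (by omega : ¬ (1:ℕ) ≤ 0), add_zero]
  rw [← Finset.mul_sum]
  have h2 := Real.sum_le_exp_of_nonneg (x := 9/5) (by norm_num) (r + 1)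
  rw [Finset.sum_range_succ'] at h2
  have h3 : Real.exp (9/5) ≤ 7 := by
    have a : Real.exp (9/5) ^ 5 = Real.exp 1 ^ 9 := by
      rw [← Real.exp_nat_mul, ← Real.exp_nat_mul]; norm_num
    have b : Real.exp 1 ^ 9 ≤ 2.72 ^ 9 := by
      gcongr; linarith [Real.exp_one_lt_d9]
    refine le_of_pow_le_pow_left₀ (n := 5) (by norm_num) (by norm_num) ?_
    rw [a]
    exact b.trans (by norm_num)
  simp only [pow_zero, Nat.factorial_zero, Nat.cast_one, div_one] at h2
  have h4 : ∑ i ∈ Finset.range r, (9/5:ℝ) ^ (i+1) / ((i+1).factorial : ℝ) ≤ 6 := by linarith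
  nlinarith

lemma kappa_le : Real.sqrt 3 * Real.exp (-(2/3)) ≤ 9/10 := by
  rw [Real.exp_neg, ← div_eq_mul_inv, div_le_iff₀ (Real.exp_pos _)]
  rw [Real.sqrt_le_left (by positivity)]
  have a : Real.exp (2/3) ^ 3 = Real.exp 1 ^ 2 := by
    rw [← Real.exp_nat_mul, ← Real.exp_nat_mul]; norm_num
  have b : (1.94 : ℝ) ≤ Real.exp (2/3) := by
    refine le_of_pow_le_pow_left₀ (n := 3) (by norm_num) (by positivity) ?_
    rw [a]
    have : (2.718:ℝ) ^ 2 ≤ Real.exp 1 ^ 2 := by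
      gcongr; linarith [Real.exp_one_gt_d9]
    exact le_trans (by norm_num) this
  nlinarith

lemma count_models {p : ℕ} (τ₀ : Finset (Fin p)) (hs : 1 ≤ τ₀.card) :
    (Finset.univ.filter (fun τ : Finset (Fin p) => τ ≠ τ₀ ∧ τ.card ≤ τ₀.card)).card ≤
      p ^ τ₀.card := by
  set s := τ₀.card with hsd
  set F := Finset.univ.filter (fun τ : Finset (Fin p) => τ.Nonempty ∧ τ.card ≤ s) with hF
  have h1 : F.card ≤ p ^ s := by
    have : F ⊆ Finset.univ.image (fun f : Fin s → Fin p => Finset.univ.image f) := by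
      intro τ hτ
      simp only [hF, Finset.mem_filter, Finset.mem_univ, true_and] at hτ
      obtain ⟨⟨a, ha⟩, hc⟩ := hτ
      simp only [Finset.mem_image, Finset.mem_univ, true_and]
      have e := τ.equivFin
      refine ⟨fun i => if h : i.1 < τ.card then (e.symm ⟨i.1, h⟩ : Fin p) else a, ?_⟩
      ext x
      simp only [Finset.mem_image, Finset.mem_univ, true_and]
      constructor
      · rintro ⟨i, hi⟩
        split_ifs at hi with h
        · rw [← hi]; exact (e.symm _).2
        · rw [← hi]; exact ha
      · intro hx
        refine ⟨⟨(e ⟨x, hx⟩).1, lt_of_lt_of_le (e ⟨x, hx⟩).2 hc⟩, ?_⟩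
        simp
    refine (Finset.card_le_card this).trans (Finset.card_image_le.trans ?_)
    simp
  have h0 : τ₀ ∈ F := by
    simp only [hF, Finset.mem_filter, Finset.mem_univ, true_and]
    exact ⟨Finset.card_pos.1 hs, le_rfl⟩
  have h2 : Finset.univ.filter (fun τ : Finset (Fin p) => τ ≠ τ₀ ∧ τ.card ≤ s) ⊆
      insert ∅ (F.erase τ₀) := by
    intro τ hτ
    simp only [hF, Finset.mem_filter, Finset.mem_univ, true_and, Finset.mem_insert,
      Finset.mem_erase] at hτ ⊢
    rcases τ.eq_empty_or_nonempty with h | h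
    · exact Or.inl h
    · exact Or.inr ⟨hτ.1, h, hτ.2⟩
  refine (Finset.card_le_card h2).trans ((Finset.card_insert_le _ _).trans ?_)
  rw [Finset.card_erase_of_mem h0]
  have := Finset.card_pos.2 ⟨_, h0⟩
  omega

/-- columns -/
def colV {n p : ℕ} (X : Matrix (Fin n) (Fin p) ℝ) (j : Fin p) : EuclideanSpace ℝ (Fin n) :=
  WithLp.toLp 2 (fun i => X i j)

/-- column span -/
def Vs {n p : ℕ} (X : Matrix (Fin n) (Fin p) ℝ) (τ : Finset (Fin p)) :
    Submodule ℝ (EuclideanSpace ℝ (Fin n)) := Submodule.span ℝ (colV X '' (τ : Set (Fin p)))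

/-- augmented column span -/
def Wv {n p : ℕ} (X : Matrix (Fin n) (Fin p) ℝ) (τ : Finset (Fin p))
    (u : EuclideanSpace ℝ (Fin n)) :
    Submodule ℝ (EuclideanSpace ℝ (Fin n)) := Vs X τ ⊔ Submodule.span ℝ {u}

lemma sqnorm_eq {n : ℕ} (v : Fin n → ℝ) : sqnorm v = ‖WithLp.toLp 2 v‖ ^ 2 := by
  rw [EuclideanSpace.real_norm_sq_eq]; rfl

lemma mulVec_toLp {n p : ℕ} (X : Matrix (Fin n) (Fin p) ℝ) (β : Fin p → ℝ) :
    WithLp.toLp 2 (X.mulVec β) = ∑ j, β j • colV X j := by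
  ext i
  simp [colV, Matrix.mulVec, dotProduct, mul_comm]

lemma mask_sum {n p : ℕ} (X : Matrix (Fin n) (Fin p) ℝ) (τ : Finset (Fin p)) (β : Fin p → ℝ) :
    WithLp.toLp 2 (X.mulVec (maskOn τ β)) = ∑ j ∈ τ, β j • colV X j := by
  rw [mulVec_toLp]
  simp [maskOn, ite_smul, Finset.sum_ite_mem]

lemma mask_mem {n p : ℕ} (X : Matrix (Fin n) (Fin p) ℝ) (τ : Finset (Fin p)) (β : Fin p → ℝ) :
    WithLp.toLp 2 (X.mulVec (maskOn τ β)) ∈ Vs X τ := by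
  rw [mask_sum]
  exact Submodule.sum_mem _ fun j hj => Submodule.smul_mem _ _
    (Submodule.subset_span ⟨j, hj, rfl⟩)

lemma exists_mask {n p : ℕ} (X : Matrix (Fin n) (Fin p) ℝ) (τ : Finset (Fin p))
    (w : EuclideanSpace ℝ (Fin n)) (hw : w ∈ Vs X τ) :
    ∃ β : Fin p → ℝ, WithLp.toLp 2 (X.mulVec (maskOn τ β)) = w := by
  obtain ⟨c, hc⟩ := Submodule.mem_span_image_finset_iff_exists_fun ℝ |>.1 hw
  refine ⟨fun j => if h : j ∈ τ then c ⟨j, h⟩ else 0, ?_⟩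
  rw [mask_sum, ← hc, ← Finset.sum_coe_sort τ]
  refine Finset.sum_congr rfl fun j _ => ?_
  simp

lemma objPen_eq {n p : ℕ} (X : Matrix (Fin n) (Fin p) ℝ) (lam : ℝ) (y u : Fin n → ℝ)
    (τ : Finset (Fin p)) :
    objPen X lam y u τ = ‖WithLp.toLp 2 y -
      (Wv X τ (WithLp.toLp 2 u)).starProjection (WithLp.toLp 2 y)‖ ^ 2 + lam * τ.card := by
  unfold objPen
  congr 1
  set W := Wv X τ (WithLp.toLp 2 u) with hW
  have key : ∀ bs : (Fin p → ℝ) × ℝ,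
      sqnorm (y - X.mulVec (maskOn τ bs.1) - bs.2 • u) = ‖WithLp.toLp 2 y -
        (WithLp.toLp 2 (X.mulVec (maskOn τ bs.1)) + bs.2 • WithLp.toLp 2 u)‖ ^ 2 := by
    intro bs
    rw [sqnorm_eq, WithLp.toLp_sub, WithLp.toLp_sub, WithLp.toLp_smul, sub_sub]
  apply le_antisymm
  · obtain ⟨a, ha, b, hb, hz⟩ := Submodule.mem_sup.1
      (Submodule.starProjection_apply_mem W (WithLp.toLp 2 y))
    obtain ⟨c, rfl⟩ := Submodule.mem_span_singleton.1 hb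
    obtain ⟨β, rfl⟩ := exists_mask X τ a ha
    refine (ciInf_le ⟨0, ?_⟩ (β, c)).trans ?_
    · rintro _ ⟨bs, rfl⟩
      simp only [key]; positivity
    · rw [key, hz]
  · refine le_ciInf fun bs => ?_
    rw [key]
    have hm : WithLp.toLp 2 (X.mulVec (maskOn τ bs.1)) + bs.2 • WithLp.toLp 2 u ∈ W :=
      Submodule.add_mem_sup (mask_mem X τ _) (Submodule.smul_mem _ _
        (Submodule.mem_span_singleton_self _))
    have : ‖WithLp.toLp 2 y - W.starProjection (WithLp.toLp 2 y)‖ ≤ ‖WithLp.toLp 2 y -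
        (WithLp.toLp 2 (X.mulVec (maskOn τ bs.1)) + bs.2 • WithLp.toLp 2 u)‖ := by
      rw [Submodule.starProjection_minimal]
      exact ciInf_le (f := fun x : W => ‖WithLp.toLp 2 y - (x : EuclideanSpace ℝ (Fin n))‖)
        ⟨0, by rintro _ ⟨x, rfl⟩; exact norm_nonneg _⟩ ⟨_, hm⟩
    gcongr

lemma proj_eq {n p : ℕ} (X : Matrix (Fin n) (Fin p) ℝ) (τ : Finset (Fin p))
    (hG : IsUnit ((subcols X τ)ᵀ * subcols X τ).det) (v : Fin n → ℝ) :
    sqnorm ((1 - proj X τ).mulVec v) =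
      ‖WithLp.toLp 2 v - (Vs X τ).starProjection (WithLp.toLp 2 v)‖ ^ 2 := by
  rw [sqnorm_eq, Matrix.sub_mulVec, Matrix.one_mulVec, WithLp.toLp_sub]
  congr 3
  symm
  set M := subcols X τ with hM
  have hsub : ∀ c : {j // j ∈ τ} → ℝ, WithLp.toLp 2 (M.mulVec c) = ∑ j, c j • colV X j := by
    intro c
    ext i
    simp [colV, Matrix.mulVec, dotProduct, mul_comm, hM, subcols]
  have hP : (proj X τ).mulVec v = M.mulVec ((Mᵀ * M)⁻¹.mulVec (Mᵀ.mulVec v)) := by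
    simp only [proj, projMat, Matrix.mulVec_mulVec]
    rw [Matrix.mul_assoc]
  apply Submodule.eq_starProjection_of_mem_of_inner_eq_zero
  · rw [hP, hsub]
    exact Submodule.sum_mem _ fun j hj => Submodule.smul_mem _ _
      (Submodule.subset_span ⟨j, j.2, rfl⟩)
  · have h0 : Mᵀ.mulVec (v - (proj X τ).mulVec v) = 0 := by
      rw [Matrix.mulVec_sub, hP, Matrix.mulVec_mulVec, Matrix.mulVec_mulVec,
        Matrix.mul_nonsing_inv _ hG, Matrix.one_mulVec, sub_self]
    have hle : Vs X τ ≤ (Submodule.span ℝ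
        {WithLp.toLp 2 v - WithLp.toLp 2 ((proj X τ).mulVec v)})ᗮ := by
      refine Submodule.span_le.2 ?_
      rintro _ ⟨j, hj, rfl⟩
      rw [SetLike.mem_coe, Submodule.mem_orthogonal_singleton_iff_inner_right]
      have h1 := congrFun h0 ⟨j, hj⟩
      simp only [Matrix.mulVec, dotProduct, Matrix.transpose_apply, hM, subcols, Matrix.of_apply,
        Pi.zero_apply] at h1
      rw [← WithLp.toLp_sub, colV, PiLp.inner_apply]
      simpa [Matrix.mulVec, dotProduct] using h1
    intro w hw
    exact (Submodule.mem_orthogonal_singleton_iff_inner_right).1 (hle hw)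

lemma Vs_mono {n p : ℕ} (X : Matrix (Fin n) (Fin p) ℝ) {τ τ' : Finset (Fin p)} (h : τ ⊆ τ') :
    Vs X τ ≤ Vs X τ' := Submodule.span_mono (Set.image_mono (by exact_mod_cast h))

lemma Wv_mono {n p : ℕ} (X : Matrix (Fin n) (Fin p) ℝ) {τ τ' : Finset (Fin p)} (h : τ ⊆ τ')
    (u) : Wv X τ u ≤ Wv X τ' u := sup_le_sup_right (Vs_mono X h) _

lemma Vs_finrank {n p : ℕ} (X : Matrix (Fin n) (Fin p) ℝ) (τ : Finset (Fin p)) :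
    Module.finrank ℝ (Vs X τ) ≤ τ.card := by
  unfold Vs
  rw [← Finset.coe_image]
  exact (finrank_span_finset_le_card _).trans Finset.card_image_le

lemma Vs_orth {n p : ℕ} (X : Matrix (Fin n) (Fin p) ℝ) (τ : Finset (Fin p)) :
    n - τ.card ≤ Module.finrank ℝ (Vs X τ)ᗮ := by
  have := Submodule.finrank_add_finrank_orthogonal (Vs X τ)
  have h2 := Vs_finrank X τ
  rw [finrank_euclideanSpace_fin] at this
  omega

lemma Wv_dim {n p : ℕ} (X : Matrix (Fin n) (Fin p) ℝ) (τ τ' : Finset (Fin p)) (h : τ ⊆ τ')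
    (u) : Module.finrank ℝ ((Wv X τ u)ᗮ ⊓ Wv X τ' u : Submodule ℝ _) ≤ (τ' \ τ).card := by
  have h1 := Submodule.finrank_add_inf_finrank_orthogonal (Wv_mono X h u)
  have h2 : Wv X τ' u = Wv X τ u ⊔ Vs X (τ' \ τ) := by
    have : Vs X τ' = Vs X τ ⊔ Vs X (τ' \ τ) := by
      unfold Vs
      rw [← Submodule.span_union, ← Set.image_union, ← Finset.coe_union,
        Finset.union_sdiff_of_subset h]
    unfold Wv
    rw [this, sup_right_comm]
  have h3 := Submodule.finrank_add_le_finrank_add_finrank (Wv X τ u) (Vs X (τ' \ τ))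
  rw [← h2] at h3
  have := Vs_finrank X (τ' \ τ)
  omega

lemma card_rel {p : ℕ} (τ τ₀ : Finset (Fin p)) :
    τ.card + (τ₀ \ τ).card = τ₀.card + (τ \ τ₀).card := by
  have h1 := Finset.card_sdiff_add_card_inter τ τ₀
  have h2 := Finset.card_sdiff_add_card_inter τ₀ τ
  rw [Finset.inter_comm] at h2
  omega

/-- failure event for fixed artificial noise -/
def failE {n p : ℕ} (X : Matrix (Fin n) (Fin p) ℝ) (lam σ : ℝ) (μ u : EuclideanSpace ℝ (Fin n))
    (τ₀ τ : Finset (Fin p)) : Set (EuclideanSpace ℝ (Fin n)) :=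
  {U | ‖(μ + σ • U) - (Wv X τ u).starProjection (μ + σ • U)‖ ^ 2 + lam * τ.card ≤
      ‖(μ + σ • U) - (Wv X τ₀ u).starProjection (μ + σ • U)‖ ^ 2 + lam * τ₀.card}

lemma small_event {n p : ℕ} (X : Matrix (Fin n) (Fin p) ℝ) (lam σ a : ℝ) (hσ : 0 < σ)
    (μ u : EuclideanSpace ℝ (Fin n)) (τ₀ τ : Finset (Fin p)) (hμ : μ ∈ Vs X τ₀)
    (hk : (τ \ τ₀).card ≤ (τ₀ \ τ).card) (hl0 : 0 ≤ lam)
    (hM : 18 * σ ^ 2 * a * (τ₀ \ τ).card ≤ ‖μ - (Wv X τ u).starProjection μ‖ ^ 2)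
    (hlam : lam ≤ 3 * σ ^ 2 * a) :
    ProbabilityTheory.stdGaussian _ (failE X lam σ μ u τ₀ τ) ≤
      ENNReal.ofReal (2 * (2 * Real.exp (-a)) ^ (τ₀ \ τ).card) := by
  set D := (τ₀ \ τ).card with hD
  set w := μ - (Wv X τ u).starProjection μ with hw
  have hc := card_rel τ τ₀
  have hcR : (τ.card : ℝ) + D = τ₀.card + (τ \ τ₀).card := by exact_mod_cast hc
  have hAB : lam * τ₀.card - lam * τ.card ≤ ‖w‖ ^ 2 / 6 := by
    have : lam * τ₀.card - lam * τ.card ≤ lam * D := by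
      have : (0:ℝ) ≤ ((τ \ τ₀).card : ℝ) := by positivity
      nlinarith
    have h2 : lam * D ≤ 3 * σ ^ 2 * a * D := by gcongr
    linarith
  have hsub : failE X lam σ μ u τ₀ τ ⊆ {U | ‖w‖ ^ 2 / (3 * σ) ≤ inner ℝ (-w) U} ∪
      {U | ‖w‖ ^ 2 / (6 * σ ^ 2) ≤
        ‖((Wv X (τ ∩ τ₀) u)ᗮ ⊓ Wv X τ u).starProjection U‖ ^ 2} := by
    intro U hU
    exact small_fail (Wv X τ u) (Wv X τ₀ u) (Wv X (τ ∩ τ₀) u)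
      (Wv_mono X Finset.inter_subset_right u) (Wv_mono X Finset.inter_subset_left u) μ U σ hσ
      (Submodule.mem_sup_left hμ) _ _ hAB hU
  have hdim : Module.finrank ℝ ((Wv X (τ ∩ τ₀) u)ᗮ ⊓ Wv X τ u : Submodule ℝ _) ≤ D := by
    refine (Wv_dim X (τ ∩ τ₀) τ Finset.inter_subset_left u).trans ?_
    rwa [Finset.sdiff_inter_self_left]
  have hexp : Real.exp (-(‖w‖ ^ 2) / (18 * σ ^ 2)) ≤ Real.exp (-a) ^ D := by
    rw [← Real.exp_nat_mul]
    apply Real.exp_le_exp.2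
    rw [div_le_iff₀ (by positivity)]
    nlinarith
  refine (measure_mono hsub).trans ((measure_union_le _ _).trans ?_)
  refine (add_le_add (lin_bound w σ hσ) (chi_bound _ D hdim _)).trans ?_
  rw [← ENNReal.ofReal_add (by positivity) (by positivity)]
  apply ENNReal.ofReal_le_ofReal
  have e1 : -(‖w‖ ^ 2 / (6 * σ ^ 2)) / 3 = -(‖w‖ ^ 2) / (18 * σ ^ 2) := by
    field_simp; ring
  rw [e1]
  have h3 : Real.sqrt 3 ≤ 2 := by
    rw [Real.sqrt_le_left (by norm_num)]; norm_num
  have h4 : Real.exp (-(‖w‖ ^ 2) / (18 * σ ^ 2)) * Real.sqrt 3 ^ D ≤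
      Real.exp (-a) ^ D * 2 ^ D := by gcongr
  have h5 : Real.exp (-a) ^ D ≤ (2 * Real.exp (-a)) ^ D := by
    gcongr
    linarith [Real.exp_pos (-a)]
  rw [← mul_pow, mul_comm (Real.exp (-a)) 2] at h4
  linarith

lemma large_event {n p : ℕ} (X : Matrix (Fin n) (Fin p) ℝ) (lam σ ell q : ℝ) (hσ : 0 < σ)
    (μ u : EuclideanSpace ℝ (Fin n)) (τ₀ τ : Finset (Fin p)) (hμ : μ ∈ Vs X τ₀)
    (hk : (τ₀ \ τ).card < (τ \ τ₀).card) (hell : 0 ≤ ell) (hq : 0 ≤ q)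
    (hlam : 3 * σ ^ 2 * ((τ₀.card : ℝ) + 1) * ell + q ≤ lam) :
    ProbabilityTheory.stdGaussian _ (failE X lam σ μ u τ₀ τ) ≤
      ENNReal.ofReal (Real.exp (-q / (3 * σ ^ 2)) *
        (Real.sqrt 3 * Real.exp (-ell)) ^ (τ \ τ₀).card) := by
  set k := (τ \ τ₀).card with hkd
  set m := (τ₀ \ τ).card with hm
  have hc := card_rel τ τ₀
  have hms : m ≤ τ₀.card := Finset.card_le_card Finset.sdiff_subset
  set W' := Wv X (τ ∪ τ₀) u
  set x := (lam * τ.card - lam * τ₀.card) / σ ^ 2 with hx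
  have hsub : failE X lam σ μ u τ₀ τ ⊆
      {U | x ≤ ‖((Wv X τ₀ u)ᗮ ⊓ W').starProjection U‖ ^ 2} := by
    intro U hU
    have := large_fail (Wv X τ u) (Wv X τ₀ u) W'
      (Wv_mono X Finset.subset_union_right u) (Wv_mono X Finset.subset_union_left u) μ U σ
      (Submodule.mem_sup_left hμ) _ _ hU
    rw [Set.mem_ofPred_eq, hx, div_le_iff₀ (by positivity)]
    linarith
  have hdim : Module.finrank ℝ ((Wv X τ₀ u)ᗮ ⊓ W' : Submodule ℝ _) ≤ k := by
    refine (Wv_dim X τ₀ (τ ∪ τ₀) Finset.subset_union_right u).trans ?_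
    rw [Finset.union_sdiff_right]
  refine (measure_mono hsub).trans ((chi_bound _ k hdim x).trans ?_)
  apply ENNReal.ofReal_le_ofReal
  rw [mul_pow, mul_comm (Real.sqrt 3 ^ k), ← mul_assoc, ← Real.exp_nat_mul, ← Real.exp_add]
  gcongr
  rw [hx, ← sub_nonneg]
  set j : ℝ := (τ.card : ℝ) - τ₀.card with hj
  have hcR : (τ.card : ℝ) + m = τ₀.card + k := by exact_mod_cast hc
  have hj1 : 1 ≤ j := by
    have : τ₀.card + 1 ≤ τ.card := by omega
    have : (τ₀.card : ℝ) + 1 ≤ τ.card := by exact_mod_cast this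
    linarith
  have hmR : (m : ℝ) ≤ τ₀.card := by exact_mod_cast hms
  have hkj : (k : ℝ) ≤ ((τ₀.card : ℝ) + 1) * j := by
    have : (0 : ℝ) ≤ τ₀.card := by positivity
    nlinarith
  have hlj : (3 * σ ^ 2 * ((τ₀.card : ℝ) + 1) * ell + q) * j ≤ lam * j := by gcongr
  have h1 : 3 * σ ^ 2 * ell * k ≤ 3 * σ ^ 2 * ell * (((τ₀.card : ℝ) + 1) * j) := by gcongr
  have h2 : q ≤ q * j := le_mul_of_one_le_right hq hj1
  have h3 : -q / (3 * σ ^ 2) + (k : ℝ) * -ell - -((lam * τ.card - lam * τ₀.card) / σ ^ 2) / 3 =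
    (lam * j - 3 * σ ^ 2 * ell * k - q) / (3 * σ ^ 2) := by
    rw [hj]; field_simp; ring
  rw [h3]
  apply div_nonneg _ (by positivity)
  nlinarith

lemma eps_bound {n p : ℕ} (X : Matrix (Fin n) (Fin p) ℝ) (lam σ a ell q γ : ℝ) (hσ : 0 < σ)
    (μ u : EuclideanSpace ℝ (Fin n)) (τ₀ : Finset (Fin p)) (hμ : μ ∈ Vs X τ₀)
    (hs : 1 ≤ τ₀.card) (hell : 0 ≤ ell) (hq : 0 ≤ q) (hγ : γ ^ 2 ≤ 1)
    (hlam : 3 * σ ^ 2 * ((τ₀.card : ℝ) + 1) * ell + q ≤ lam) (hlam2 : lam ≤ 3 * σ ^ 2 * a)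
    (hle : (Real.sqrt 3 * Real.exp (-ell)) *
      (((p - τ₀.card : ℕ) : ℝ) * (τ₀.card : ℝ)) ≤ 9/10)
    (hz6 : 6 * (p : ℝ) ^ 2 * Real.exp (-a) ≤ 1)
    (hC : ∀ τ : Finset (Fin p), τ ≠ τ₀ → τ.card ≤ τ₀.card → 18 * σ ^ 2 * a * (τ₀ \ τ).card ≤
      (1 - γ ^ 2) * ‖μ - (Vs X τ).starProjection μ‖ ^ 2)
    (hu : ∀ τ : Finset (Fin p), τ ≠ τ₀ → τ.card ≤ τ₀.card →
      (inner ℝ u (μ - (Vs X τ).starProjection μ)) ^ 2 ≤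
      γ ^ 2 * ‖(Vs X τ)ᗮ.starProjection u‖ ^ 2 * ‖μ - (Vs X τ).starProjection μ‖ ^ 2) :
    ProbabilityTheory.stdGaussian _ {U | ∃ τ, τ ≠ τ₀ ∧ U ∈ failE X lam σ μ u τ₀ τ} ≤
      ENNReal.ofReal (6 * (p : ℝ) ^ 2 * Real.exp (-a) + 3 * Real.exp (-q / (3 * σ ^ 2))) := by
  have hl0 : 0 ≤ lam := le_trans (by positivity) hlam
  set F : Finset (Fin p) → ℝ := fun τ =>
    (if 1 ≤ (τ₀ \ τ).card ∧ (τ \ τ₀).card ≤ (τ₀ \ τ).card then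
      2 * (2 * Real.exp (-a)) ^ (τ₀ \ τ).card else 0) +
    (if (τ₀ \ τ).card < (τ \ τ₀).card then
      Real.exp (-q / (3 * σ ^ 2)) * (Real.sqrt 3 * Real.exp (-ell)) ^ (τ \ τ₀).card else 0) with hF
  have hF0 : ∀ τ, 0 ≤ F τ := by
    intro τ
    simp only [hF]
    apply add_nonneg <;> split_ifs <;> positivity
  have hsub : {U | ∃ τ, τ ≠ τ₀ ∧ U ∈ failE X lam σ μ u τ₀ τ} ⊆
      ⋃ τ : Finset (Fin p), {U | τ ≠ τ₀ ∧ U ∈ failE X lam σ μ u τ₀ τ} := by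
    rintro U ⟨τ, h⟩
    exact Set.mem_iUnion.2 ⟨τ, h⟩
  have hb : ∀ τ : Finset (Fin p), ProbabilityTheory.stdGaussian _
      {U | τ ≠ τ₀ ∧ U ∈ failE X lam σ μ u τ₀ τ} ≤ ENNReal.ofReal (F τ) := by
    intro τ
    by_cases hτ : τ = τ₀
    · have : {U | τ ≠ τ₀ ∧ U ∈ failE X lam σ μ u τ₀ τ} = ∅ := by
        ext U; simp [hτ]
      rw [this]; simp
    refine (measure_mono (fun U hU => hU.2)).trans (?_ :
      ProbabilityTheory.stdGaussian _ (failE X lam σ μ u τ₀ τ) ≤ _)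
    have hc := card_rel τ τ₀
    by_cases hk : (τ₀ \ τ).card < (τ \ τ₀).card
    · have e : F τ = Real.exp (-q / (3 * σ ^ 2)) *
          (Real.sqrt 3 * Real.exp (-ell)) ^ (τ \ τ₀).card := by
        simp only [hF]
        rw [if_neg (by omega), if_pos hk, zero_add]
      rw [e]
      exact large_event X lam σ ell q hσ μ u τ₀ τ hμ hk hell hq hlam
    · have hcard : τ.card ≤ τ₀.card := by omega
      have hD : 1 ≤ (τ₀ \ τ).card := by
        rw [Nat.one_le_iff_ne_zero, Ne, Finset.card_eq_zero, Finset.sdiff_eq_empty_iff_subset]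
        intro h
        exact hτ (Finset.eq_of_subset_of_card_le h hcard).symm
      have e : F τ = 2 * (2 * Real.exp (-a)) ^ (τ₀ \ τ).card := by
        simp only [hF]
        rw [if_pos ⟨hD, by omega⟩, if_neg hk, add_zero]
      rw [e]
      exact small_event X lam σ a hσ μ u τ₀ τ hμ (by omega) hl0
        ((hC τ hτ hcard).trans (good_angle _ _ _ _ (hu τ hτ hcard))) hlam2
  refine (measure_mono hsub).trans ((measure_iUnion_fintype_le _ _).trans ?_)
  refine (Finset.sum_le_sum fun τ _ => hb τ).trans ?_
  rw [← ENNReal.ofReal_sum_of_nonneg (fun τ _ => hF0 τ)]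
  apply ENNReal.ofReal_le_ofReal
  simp only [hF]
  rw [Finset.sum_add_distrib]
  exact add_le_add (small_sum τ₀ hs _ (Real.exp_pos _).le hz6)
    (large_sum τ₀ hs _ _ (by positivity) (by positivity) hle)

lemma prob_assembly {α : Type*} [MeasurableSpace α] (g : Measure α) [IsProbabilityMeasure g]
    (d : ℕ) (G : Set (α × α)) (hG : MeasurableSet G) (A : Set α) (ε : ℝ≥0∞)
    (h : ∀ u ∉ A, g {U | (U, u) ∈ G} ≤ ε) :
    (g.prod (Measure.pi fun _ : Fin d => g)) {ω | ∀ b, (ω.1, ω.2 b) ∈ G} ≤ ε + g A ^ d := by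
  have hm : MeasurableSet {ω : α × (Fin d → α) | ∀ b, (ω.1, ω.2 b) ∈ G} := by
    rw [Set.ofPred_forall]
    refine MeasurableSet.iInter fun b => ?_
    have : Measurable fun ω : α × (Fin d → α) => (ω.1, ω.2 b) := by fun_prop
    exact this hG
  rw [Measure.prod_apply_symm hm]
  set B := toMeasurable g A with hB
  have hBm : MeasurableSet B := measurableSet_toMeasurable g A
  set S : Set (Fin d → α) := Set.pi Set.univ fun _ => B with hS
  have hSm : MeasurableSet S := MeasurableSet.univ_pi fun _ => hBm
  calc _ ≤ ∫⁻ v, (ε + S.indicator 1 v) ∂(Measure.pi fun _ : Fin d => g) := by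
        refine lintegral_mono fun v => ?_
        by_cases hv : v ∈ S
        · rw [Set.indicator_of_mem hv]
          exact prob_le_one.trans le_add_self
        · rw [Set.indicator_of_notMem hv, add_zero]
          have : ∃ b, v b ∉ B := by
            by_contra hcon
            push Not at hcon
            exact hv fun b _ => hcon b
          obtain ⟨b, hb⟩ := this
          refine (measure_mono ?_).trans (h (v b) fun hA => hb (subset_toMeasurable g A hA))
          intro U hU
          exact hU b
    _ = ε + g A ^ d := by
        rw [lintegral_add_left measurable_const, lintegral_const, measure_univ, mul_one,
          lintegral_indicator_one hSm, hS, Measure.pi_pi]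
        simp [hB, measure_toMeasurable]

lemma objPen_measurable {n p : ℕ} (X : Matrix (Fin n) (Fin p) ℝ) (lam : ℝ) (τ : Finset (Fin p)) :
    Measurable fun q : (Fin n → ℝ) × (Fin n → ℝ) => objPen X lam q.1 q.2 τ := by
  unfold objPen
  refine Measurable.add_const ?_ _
  apply UpperSemicontinuous.measurable
  apply upperSemicontinuous_ciInf
  · intro q
    refine ⟨0, ?_⟩
    rintro _ ⟨bs, rfl⟩
    simp only [sqnorm]
    positivity
  · intro bs
    apply Continuous.upperSemicontinuous
    unfold sqnorm
    fun_prop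

lemma gauss_pre {n : ℕ} (S : Set (EuclideanSpace ℝ (Fin n))) :
    stdGaussian n {u | WithLp.toLp 2 u ∈ S} ≤ ProbabilityTheory.stdGaussian _ S := by
  rw [← map_pi_eq_stdGaussian]
  exact Measure.le_map_apply (by fun_prop) S

instance instProbGauss (n : ℕ) : IsProbabilityMeasure (stdGaussian n) := by
  unfold stdGaussian; infer_instance

lemma objPen_measurable' {n p : ℕ} (X : Matrix (Fin n) (Fin p) ℝ) (lam : ℝ) (τ : Finset (Fin p))
    (m : Fin n → ℝ) (σ : ℝ) :
    Measurable fun q : (Fin n → ℝ) × (Fin n → ℝ) => objPen X lam (m + σ • q.1) q.2 τ := by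
  have h1 : Measurable fun q : (Fin n → ℝ) × (Fin n → ℝ) => m + σ • q.1 :=
    (measurable_fst.const_smul σ).const_add m
  have h2 : Measurable fun q : (Fin n → ℝ) × (Fin n → ℝ) => (m + σ • q.1, q.2) :=
    h1.prodMk measurable_snd
  have h3 := (objPen_measurable X lam τ).comp h2
  simp only [Function.comp_def] at h3
  exact h3

set_option maxHeartbeats 400000 in
/-- **Lemma (penalized candidate set, asymptotic-style bound).** For
`cos(0.3π) < γ₁ < 1` and the tuning parameter in the prescribed window,
`ℙ(τ₀ ∉ S^(d)) ≤ L(γ₁) + 3 exp(−nt/(3σ₀²)) + [2 (arccos γ₁)^{n−|τ₀|−1} p^{|τ₀|}]^d`. -/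
theorem candidate_set_penalized_asymptotic_bound {n p : ℕ}
    (X : Matrix (Fin n) (Fin p) ℝ) (τ₀ : Finset (Fin p)) (β₀ : Fin p → ℝ)
    (hβsupp : ∀ j ∉ τ₀, β₀ j = 0) (hβne : ∀ j ∈ τ₀, β₀ j ≠ 0)
    (σ₀ : ℝ) (hσ₀ : 0 < σ₀)
    (hGram : ∀ τ : Finset (Fin p), τ.card ≤ τ₀.card →
      IsUnit ((subcols X τ)ᵀ * subcols X τ).det)
    (hid : Identifiable X τ₀ β₀)
    (γ₁ : ℝ) (hγ₁ : Real.cos (0.3 * Real.pi) < γ₁ ∧ γ₁ < 1)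
    (t : ℝ) (ht : 0 < t) (lam : ℝ)
    (hlam : lam / (n : ℝ) ∈ Set.Icc
      (3 * σ₀ ^ 2 * ((τ₀.card : ℝ) + 1) *
          (Real.log ((p : ℝ) - (τ₀.card : ℝ)) + Real.log (τ₀.card : ℝ) + 2/3) / (n : ℝ)
        + t)
      ((1 - γ₁ ^ 2) * Cmin X τ₀ β₀ / 6))
    (tauHat : (Fin n → ℝ) → (Fin n → ℝ) → Finset (Fin p))
    (hmin : ∀ (y ustar : Fin n → ℝ) (τ : Finset (Fin p)),
      objPen X lam y ustar (tauHat y ustar) ≤ objPen X lam y ustar τ)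
    (d : ℕ) :
    jointMeasure n d
        {ω | ∀ b : Fin d, tauHat (X.mulVec β₀ + σ₀ • ω.1) (ω.2 b) ≠ τ₀} ≤
      ENNReal.ofReal
        (6 * Real.exp (-((n : ℝ) / (18 * σ₀ ^ 2)) *
            ((1 - γ₁ ^ 2) * Cmin X τ₀ β₀ - 36 * (Real.log (p : ℝ) / (n : ℝ)) * σ₀ ^ 2)) +
          3 * Real.exp (-((n : ℝ) * t) / (3 * σ₀ ^ 2)) +
          (2 * Real.arccos γ₁ ^ (n - τ₀.card - 1) * (p : ℝ) ^ τ₀.card) ^ d) := by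
  set s := τ₀.card with hs_def
  set C := Cmin X τ₀ β₀ with hC_def
  obtain ⟨hγl, hγ1⟩ := hγ₁
  obtain ⟨hlo, hup⟩ := hlam
  have hpi := Real.pi_pos
  have hpi2 := Real.pi_lt_d2
  have hcos : 0 < Real.cos (0.3 * Real.pi) :=
    Real.cos_pos_of_mem_Ioo ⟨by linarith, by linarith⟩
  have hγ0 : 0 < γ₁ := hcos.trans hγl
  have hγsq : γ₁ ^ 2 < 1 := by nlinarith
  have harc : Real.arccos γ₁ ≤ 1 := by
    have h1 : Real.arccos γ₁ ≤ Real.arccos (Real.cos (0.3 * Real.pi)) :=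
      Real.arccos_le_arccos hγl.le
    rw [Real.arccos_cos (by linarith) (by linarith)] at h1
    linarith
  have harc0 := Real.arccos_nonneg γ₁
  have hsp : s ≤ p := by simpa using Finset.card_le_univ τ₀
  set ell := Real.log ((p : ℝ) - (s : ℝ)) + Real.log (s : ℝ) + 2/3 with hell_def
  have hcast : (p : ℝ) - (s : ℝ) = ((p - s : ℕ) : ℝ) := by rw [Nat.cast_sub hsp]
  have hell : 0 ≤ ell := by
    rw [hell_def, hcast]
    have := Real.log_natCast_nonneg (p - s)
    have := Real.log_natCast_nonneg s
    linarith
  have hn : 0 < n := by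
    rcases Nat.eq_zero_or_pos n with h | h
    · subst h
      simp only [Nat.cast_zero, div_zero] at hlo
      linarith
    · exact h
  have hnR : (0 : ℝ) < n := by exact_mod_cast hn
  have hlo' : 3 * σ₀ ^ 2 * ((s : ℝ) + 1) * ell + n * t ≤ lam := by
    have := mul_le_mul_of_nonneg_right hlo hnR.le
    rw [div_mul_cancel₀ _ hnR.ne', add_mul, div_mul_cancel₀ _ hnR.ne'] at this
    linarith
  have hup' : lam ≤ n * ((1 - γ₁ ^ 2) * C / 6) := by
    have := mul_le_mul_of_nonneg_right hup hnR.le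
    rw [div_mul_cancel₀ _ hnR.ne'] at this
    linarith
  have hlampos : 0 < lam := by
    have : 0 < (n : ℝ) * t := by positivity
    have : 0 ≤ 3 * σ₀ ^ 2 * ((s : ℝ) + 1) * ell := by positivity
    linarith
  have hCpos : 0 < C := by
    by_contra hc
    push Not at hc
    have h1 : (1 - γ₁ ^ 2) * C ≤ 0 := mul_nonpos_of_nonneg_of_nonpos (by linarith) hc
    have : n * ((1 - γ₁ ^ 2) * C / 6) ≤ 0 :=
      mul_nonpos_of_nonneg_of_nonpos hnR.le (by linarith)
    linarith
  have hs1 : 1 ≤ s := by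
    by_contra hc
    have hs0 : s = 0 := by omega
    have hτ : τ₀ = ∅ := Finset.card_eq_zero.1 hs0
    have : {τ : Finset (Fin p) | τ ≠ τ₀ ∧ τ.card ≤ τ₀.card} = ∅ := by
      ext τ
      simp [hτ]
    rw [hC_def, Cmin, this, Set.image_empty, Real.sInf_empty] at hCpos
    exact lt_irrefl _ hCpos
  have hp1 : 1 ≤ p := hs1.trans hsp
  have hpR : (1 : ℝ) ≤ p := by exact_mod_cast hp1
  set a := (n : ℝ) * (1 - γ₁ ^ 2) * C / (18 * σ₀ ^ 2) with ha_def
  have ha : 18 * σ₀ ^ 2 * a = n * (1 - γ₁ ^ 2) * C := by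
    rw [ha_def]; field_simp
  have hL : 6 * Real.exp (-((n : ℝ) / (18 * σ₀ ^ 2)) *
      ((1 - γ₁ ^ 2) * C - 36 * (Real.log (p : ℝ) / (n : ℝ)) * σ₀ ^ 2)) =
      6 * (p : ℝ) ^ 2 * Real.exp (-a) := by
    have e : -((n : ℝ) / (18 * σ₀ ^ 2)) *
      ((1 - γ₁ ^ 2) * C - 36 * (Real.log (p : ℝ) / (n : ℝ)) * σ₀ ^ 2) =
      ((2 : ℕ) : ℝ) * Real.log p + -a := by
      rw [ha_def]; push_cast; field_simp; ring
    rw [e, Real.exp_add, Real.exp_nat_mul, Real.exp_log (by linarith)]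
    ring
  rw [hL]
  have hT0 := Real.exp_pos (-((n : ℝ) * t) / (3 * σ₀ ^ 2))
  have hthird : 0 ≤ (2 * Real.arccos γ₁ ^ (n - s - 1) * (p : ℝ) ^ s) ^ d := by positivity
  have hprob : IsProbabilityMeasure (jointMeasure n d) := by
    unfold jointMeasure; infer_instance
  have hone : ∀ r : ℝ, 1 ≤ r → jointMeasure n d
      {ω | ∀ b : Fin d, tauHat (X.mulVec β₀ + σ₀ • ω.1) (ω.2 b) ≠ τ₀} ≤ ENNReal.ofReal r := by
    intro r hr
    refine prob_le_one.trans ?_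
    rw [← ENNReal.ofReal_one]
    exact ENNReal.ofReal_le_ofReal hr
  by_cases hz6 : 6 * (p : ℝ) ^ 2 * Real.exp (-a) ≤ 1
  swap
  · apply hone
    push Not at hz6
    linarith
  by_cases hns : n ≤ s + 1
  · apply hone
    have : n - s - 1 = 0 := by omega
    rw [this, pow_zero, mul_one]
    have h1 : (1:ℝ) ≤ (p : ℝ) ^ s := one_le_pow₀ hpR
    have h2 : (1:ℝ) ≤ (2 * (p : ℝ) ^ s) ^ d := one_le_pow₀ (by linarith)
    have h3 : 0 ≤ 6 * (p : ℝ) ^ 2 * Real.exp (-a) := by positivity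
    linarith
  push Not at hns
  set μ : EuclideanSpace ℝ (Fin n) := WithLp.toLp 2 (X.mulVec β₀) with hμ_def
  have hμ : μ ∈ Vs X τ₀ := by
    have : maskOn τ₀ β₀ = β₀ := by
      ext j
      by_cases hj : j ∈ τ₀
      · simp [maskOn, hj]
      · simp [maskOn, hj, hβsupp j hj]
    rw [hμ_def, ← this]
    exact mask_mem X τ₀ β₀
  have hle : (Real.sqrt 3 * Real.exp (-ell)) * (((p - s : ℕ) : ℝ) * (s : ℝ)) ≤ 9/10 := by
    rcases Nat.eq_zero_or_pos (p - s) with h0 | h0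
    · rw [h0]; norm_num
    · have hr : (0 : ℝ) < ((p - s : ℕ) : ℝ) := by exact_mod_cast h0
      have hsR : (0 : ℝ) < (s : ℝ) := by exact_mod_cast hs1
      have e : Real.exp (-ell) =
          Real.exp (-(2/3)) / (((p - s : ℕ) : ℝ) * (s : ℝ)) := by
        rw [hell_def, hcast, show -(Real.log ((p - s : ℕ) : ℝ) + Real.log (s : ℝ) + 2/3) =
          -(2/3) - (Real.log ((p - s : ℕ) : ℝ) + Real.log (s : ℝ)) by ring, Real.exp_sub,
          Real.exp_add, Real.exp_log hr, Real.exp_log hsR]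
      rw [e, mul_assoc, div_mul_cancel₀ _ (by positivity)]
      exact kappa_le
  have hC : ∀ τ : Finset (Fin p), τ ≠ τ₀ → τ.card ≤ τ₀.card →
      18 * σ₀ ^ 2 * a * (τ₀ \ τ).card ≤
      (1 - γ₁ ^ 2) * ‖μ - (Vs X τ).starProjection μ‖ ^ 2 := by
    intro τ hτ hc
    rw [hμ_def, ← proj_eq X τ (hGram τ hc), ha]
    have h1 : C ≤ sqnorm ((1 - proj X τ).mulVec (X.mulVec β₀)) /
        ((n * max (τ₀ \ τ).card 1 : ℕ) : ℝ) := by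
      rw [hC_def, Cmin]
      exact csInf_le ((Set.toFinite _).bddBelow) ⟨τ, ⟨hτ, hc⟩, rfl⟩
    have h2 : 0 < n * max (τ₀ \ τ).card 1 := Nat.mul_pos hn (by simp)
    rw [le_div_iff₀ (by exact_mod_cast h2)] at h1
    have h3 : (n : ℝ) * (τ₀ \ τ).card ≤ ((n * max (τ₀ \ τ).card 1 : ℕ) : ℝ) := by
      rw [Nat.cast_mul]
      have : ((τ₀ \ τ).card : ℝ) ≤ ((max (τ₀ \ τ).card 1 : ℕ) : ℝ) := by
        exact_mod_cast le_max_left _ _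
      gcongr
    have h4 : C * ((n : ℝ) * (τ₀ \ τ).card) ≤ sqnorm ((1 - proj X τ).mulVec (X.mulVec β₀)) :=
      (mul_le_mul_of_nonneg_left h3 hCpos.le).trans h1
    calc _ = (1 - γ₁ ^ 2) * (C * ((n : ℝ) * (τ₀ \ τ).card)) := by ring
      _ ≤ _ := mul_le_mul_of_nonneg_left h4 (by linarith)
  -- bad angles
  set bad : Finset (Fin p) → Set (EuclideanSpace ℝ (Fin n)) := fun τ =>
    {u | γ₁ ^ 2 * ‖(Vs X τ)ᗮ.starProjection u‖ ^ 2 * ‖μ - (Vs X τ).starProjection μ‖ ^ 2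
        < (inner ℝ u (μ - (Vs X τ).starProjection μ)) ^ 2} with hbad
  set Fs := Finset.univ.filter (fun τ : Finset (Fin p) => τ ≠ τ₀ ∧ τ.card ≤ τ₀.card) with hFs
  set A : Set (Fin n → ℝ) := {u | WithLp.toLp 2 u ∈ ⋃ τ ∈ Fs, bad τ} with hA
  have hAle : stdGaussian n A ≤
      ENNReal.ofReal (2 * Real.arccos γ₁ ^ (n - s - 1) * (p : ℝ) ^ s) := by
    refine (gauss_pre _).trans ((measure_biUnion_finset_le _ _).trans ?_)
    have hb : ∀ τ ∈ Fs, ProbabilityTheory.stdGaussian _ (bad τ) ≤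
        ENNReal.ofReal (2 * Real.arccos γ₁ ^ (n - s - 1)) := by
      intro τ hτ
      simp only [hFs, Finset.mem_filter, Finset.mem_univ, true_and] at hτ
      refine angle_bound (Vs X τ) μ γ₁ hγ0 hγ1 harc _ ?_
      have := Vs_orth X τ
      omega
    refine (Finset.sum_le_sum hb).trans ?_
    rw [Finset.sum_const, nsmul_eq_mul, ← ENNReal.ofReal_natCast,
      ← ENNReal.ofReal_mul (by positivity)]
    apply ENNReal.ofReal_le_ofReal
    have hcnt : (Fs.card : ℝ) ≤ (p : ℝ) ^ s := by exact_mod_cast count_models τ₀ hs1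
    rw [mul_comm]
    gcongr
  set G : Set ((Fin n → ℝ) × (Fin n → ℝ)) := {q | ∃ τ, τ ≠ τ₀ ∧
    objPen X lam (X.mulVec β₀ + σ₀ • q.1) q.2 τ ≤
      objPen X lam (X.mulVec β₀ + σ₀ • q.1) q.2 τ₀} with hG
  have hGm : MeasurableSet G := by
    have hmeas : ∀ τ : Finset (Fin p), Measurable fun q : (Fin n → ℝ) × (Fin n → ℝ) =>
        objPen X lam (X.mulVec β₀ + σ₀ • q.1) q.2 τ := by
      intro τ
      exact objPen_measurable' X lam τ _ _
    have : G = ⋃ τ ∈ {τ : Finset (Fin p) | τ ≠ τ₀},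
        {q | objPen X lam (X.mulVec β₀ + σ₀ • q.1) q.2 τ ≤
      objPen X lam (X.mulVec β₀ + σ₀ • q.1) q.2 τ₀} := by
      ext q
      simp [hG]
    rw [this]
    exact MeasurableSet.biUnion (Set.to_countable _) fun τ _ =>
      measurableSet_le (hmeas τ) (hmeas τ₀)
  have hε : ∀ u ∉ A, stdGaussian n {U | (U, u) ∈ G} ≤
      ENNReal.ofReal (6 * (p : ℝ) ^ 2 * Real.exp (-a) +
        3 * Real.exp (-((n : ℝ) * t) / (3 * σ₀ ^ 2))) := by
    intro u hu
    have key := eps_bound X lam σ₀ a ell ((n : ℝ) * t) γ₁ hσ₀ μ (WithLp.toLp 2 u) τ₀ hμ hs1 hell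
      (by positivity) hγsq.le hlo' (by nlinarith) hle hz6 hC (by
        intro τ h1 h2
        by_contra hcon
        push Not at hcon
        apply hu
        simp only [hA]
        refine Set.mem_biUnion (x := τ) ?_ hcon
        simp only [hFs]
        simp [h1, h2])
    refine le_trans (measure_mono ?_) ((gauss_pre _).trans key)
    rintro U ⟨τ, h1, h2⟩
    refine ⟨τ, h1, ?_⟩
    rw [objPen_eq, objPen_eq, WithLp.toLp_add, WithLp.toLp_smul] at h2
    exact h2
  have hsub : {ω : (Fin n → ℝ) × (Fin d → Fin n → ℝ) |
      ∀ b : Fin d, tauHat (X.mulVec β₀ + σ₀ • ω.1) (ω.2 b) ≠ τ₀} ⊆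
      {ω | ∀ b, (ω.1, ω.2 b) ∈ G} := by
    intro ω hω b
    exact ⟨_, hω b, hmin _ _ _⟩
  refine (measure_mono hsub).trans ((prob_assembly (stdGaussian n) d G hGm A _ hε).trans ?_)
  rw [ENNReal.ofReal_add (by positivity) hthird]
  gcongr
  rw [ENNReal.ofReal_pow (by positivity)]
  gcongr

end ReproSamples
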